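/- arXiv:1212.1905 — 2 statements merged into one kernel-verified Lean document; each statement's English description precedes it below -/
import Mathlib

section
/- Fix an integer k ≥ 3. Let (m_j) and (n_j) be sequences of positive integers tending to infinity with m_j/n_j → c ∈ (2/k, ∞), and let λ_j > 0 be the unique positive root of ψ(λ) = k·m_j/n_j. Then there is a constant K such that for all sufficiently large j, | |C_{m_j,n_j}| · λ_j^{k m_j} · √(2π n_j λ_j ψ′(λ_j)) / ((k m_j)! · f(λ_j)^{n_j}) − 1 | ≤ K/n_j. (Here λψ′(λ) equals the variance of the truncated Poisson variable Z(λ) with P(Z = i) = (λ^i/i!)/f(λ) for i ≥ 2.) -/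
open scoped Classical

/-- `f(x) = e^x - 1 - x`. -/
noncomputable def fEx (x : ℝ) : ℝ := Real.exp x - 1 - x

/-- `ψ(x) = x (e^x - 1) / (e^x - 1 - x)` for `x ≠ 0`, extended by `ψ(0) = 2`. -/
noncomputable def psi (x : ℝ) : ℝ :=
  if x = 0 then 2 else x * (Real.exp x - 1) / (Real.exp x - 1 - x)

/-- `C_{m,n}`: allocations of `k` distinguishable chips per row (over `m` rows)
to `n` columns, such that every column receives at least `2` chips. -/
noncomputable def chipSet (k m n : ℕ) : Finset (Fin m × Fin k → Fin n) :=
  Finset.univ.filter (fun φ =>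
    ∀ j : Fin n, 2 ≤ (Finset.univ.filter (fun p : Fin m × Fin k => φ p = j)).card)

/-- The successive derivatives of `exp z - 1 - z`. -/
noncomputable def FD (i : ℕ) (z : ℂ) : ℂ :=
  if i = 0 then Complex.exp z - 1 - z else if i = 1 then Complex.exp z - 1 else Complex.exp z

lemma FD_hasDeriv (i : ℕ) (z : ℂ) : HasDerivAt (FD i) (FD (i+1) z) z := by
  have h0 := Complex.hasDerivAt_exp z
  rcases i with _ | _ | i
  · have : FD 0 = fun z => Complex.exp z - 1 - z := by funext z; simp [FD]
    rw [this]
    have h1 := (h0.sub_const 1).fun_sub (hasDerivAt_id' z)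
    simpa [FD] using h1
  · have : FD 1 = fun z => Complex.exp z - 1 := by funext z; simp [FD]
    simp only [zero_add]
    rw [this]
    simpa [FD] using (h0.sub_const 1)
  · have : FD (i+1+1) = fun z => Complex.exp z := by funext z; simp [FD]
    rw [this]
    simpa [FD] using h0

lemma FD_iter (n M : ℕ) : iteratedDeriv M (fun z => (FD 0 z)^n) =
    fun z => ∑ φ : Fin M → Fin n, ∏ j, FD (Finset.univ.filter (fun p => φ p = j)).card z := by
  induction M with
  | zero => funext z; simp
  | succ M ih =>
    rw [iteratedDeriv_succ, ih]
    funext z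
    have key : ∀ φ : Fin M → Fin n, HasDerivAt
        (fun z => ∏ j, FD (Finset.univ.filter (fun p => φ p = j)).card z)
        (∑ i, ∏ j, FD (Finset.univ.filter
          (fun p : Fin (M+1) => (Fin.cons i φ : Fin (M+1) → Fin n) p = j)).card z) z := by
      intro φ
      have := HasDerivAt.fun_finsetProd (u := (Finset.univ : Finset (Fin n)))
        (f := fun j z => FD (Finset.univ.filter (fun p => φ p = j)).card z)
        (fun j _ => FD_hasDeriv (Finset.univ.filter (fun p => φ p = j)).card z)
      refine this.congr_deriv (Eq.symm ?_)
      refine Finset.sum_congr rfl fun i _ => ?_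
      rw [← Finset.prod_erase_mul Finset.univ _ (Finset.mem_univ i), smul_eq_mul]
      congr 1
      · refine Finset.prod_congr rfl fun j hj => ?_
        have hij : ¬ i = j := fun h => (Finset.ne_of_mem_erase hj) h.symm
        congr 1
        simp only [Finset.card_filter, Fin.sum_univ_succ, Fin.cons_zero, Fin.cons_succ, hij,
          if_false, zero_add]
      · congr 1
        simp only [Finset.card_filter, Fin.sum_univ_succ, Fin.cons_zero, Fin.cons_succ, if_true]
        ring
    have := HasDerivAt.fun_sum (u := (Finset.univ : Finset (Fin M → Fin n)))
      (A := fun (φ : Fin M → Fin n) z => ∏ j, FD (Finset.univ.filter (fun p => φ p = j)).card z)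
      (fun φ _ => key φ)
    rw [this.deriv, Finset.sum_comm, ← Fintype.sum_prod_type']
    exact Fintype.sum_equiv (Fin.consEquiv (fun _ : Fin (M+1) => Fin n)) _ _ (fun x => by
      simp only [Fin.consEquiv, Equiv.coe_fn_mk]
      refine Finset.prod_congr rfl fun j _ => ?_
      congr!)

lemma card_chip (k m n : ℕ) : ((chipSet k m n).card : ℂ) =
    iteratedDeriv (k * m) (fun z => (FD 0 z)^n) 0 := by
  rw [mul_comm k m, FD_iter]
  have h1 : ∀ i, FD i 0 = if 2 ≤ i then 1 else 0 := by
    intro i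
    rcases i with _ | _ | i <;> simp [FD]
  simp only [h1, Finset.prod_ite_zero, chipSet, Finset.prod_const_one, Finset.card_filter,
    Nat.cast_sum, Nat.cast_ite, Nat.cast_one, Nat.cast_zero]
  refine Fintype.sum_equiv (Equiv.arrowCongr finProdFinEquiv (Equiv.refl _)) _ _ (fun φ => ?_)
  refine if_congr ?_ rfl rfl
  simp only [Finset.mem_univ, true_implies]
  refine forall_congr' fun j => ?_
  rw [← Equiv.sum_comp (finProdFinEquiv (m := m) (n := k))]
  simp [Equiv.arrowCongr]

lemma chip_integral (k m n : ℕ) (l : ℝ) (hl : 0 < l) :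
    ((chipSet k m n).card : ℂ) * l ^ (k*m) / (Nat.factorial (k*m) : ℂ) =
    (2 * Real.pi : ℂ)⁻¹ * ∫ θ in (-Real.pi)..Real.pi,
      (FD 0 (l * Complex.exp (θ * Complex.I)))^n *
        Complex.exp (-(θ * Complex.I) * ((k*m : ℕ) : ℂ)) := by
  have hd : DiffContOnCl ℂ (fun z => (FD 0 z)^n) (Metric.ball 0 l) := by
    apply Differentiable.diffContOnCl
    intro z
    exact (FD_hasDeriv 0 z).differentiableAt.pow n
  have h := DiffContOnCl.circleIntegral_one_div_sub_center_pow_smul hl (k*m) hd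
  rw [← card_chip] at h
  set M := k * m
  have hper : Function.Periodic (fun θ : ℝ => (FD 0 (l * Complex.exp (θ * Complex.I)))^n *
        Complex.exp (-(θ * Complex.I) * (M : ℂ))) (2 * Real.pi) := by
    intro θ
    have e1 : Complex.exp (((θ + 2 * Real.pi : ℝ) : ℂ) * Complex.I) = Complex.exp (θ * Complex.I) := by
      rw [← Complex.exp_periodic (θ * Complex.I)]
      congr 1; push_cast; ring
    have e2 : ∀ t : ℝ, Complex.exp (-(t * Complex.I) * (M : ℂ)) =
       ((Complex.exp (t * Complex.I))^M)⁻¹ := by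
      intro t
      rw [← Complex.exp_nat_mul, ← Complex.exp_neg]
      congr 1; ring
    simp only [e2, e1]
  have h2 := hper.intervalIntegral_add_eq 0 (-Real.pi)
  rw [zero_add, show -Real.pi + 2 * Real.pi = Real.pi by ring] at h2
  rw [← h2]
  have hlc : (l : ℂ) ≠ 0 := by exact_mod_cast hl.ne'
  have h3 : (∮ z in C(0, l), (1 / (z - 0) ^ (M + 1)) • (FD 0 z)^n) =
     (Complex.I / l^M) * ∫ θ in (0:ℝ)..(2 * Real.pi), (FD 0 (l * Complex.exp (θ * Complex.I)))^n *
        Complex.exp (-(θ * Complex.I) * (M : ℂ)) := by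
    rw [circleIntegral, ← intervalIntegral.integral_const_mul]
    refine intervalIntegral.integral_congr fun θ _ => ?_
    have e3 : Complex.exp (-(θ * Complex.I) * (M : ℂ)) =
       ((Complex.exp (θ * Complex.I))^M)⁻¹ := by
      rw [← Complex.exp_nat_mul, ← Complex.exp_neg]
      congr 1; ring
    simp only [deriv_circleMap, circleMap, zero_add, sub_zero, smul_eq_mul, e3]
    have := Complex.exp_ne_zero (θ * Complex.I)
    field_simp
    ring
  rw [h3] at h
  have hpi : (Real.pi : ℂ) ≠ 0 := by exact_mod_cast Real.pi_ne_zero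
  have hf : (Nat.factorial M : ℂ) ≠ 0 := by exact_mod_cast Nat.factorial_ne_zero M
  rw [smul_eq_mul] at h
  set J := ∫ θ in (0:ℝ)..(2 * Real.pi), (FD 0 (l * Complex.exp (θ * Complex.I)))^n *
        Complex.exp (-(θ * Complex.I) * (M : ℂ))
  have hI := Complex.I_ne_zero
  field_simp at h ⊢
  rw [h]

lemma pow_taylor (u v : ℂ) (r : ℝ) (hu : ‖u‖ ≤ r) (hv : ‖v‖ ≤ r) (N : ℕ) :
    ‖u^(N+2) - v^(N+2) - ((N+2 : ℕ) : ℂ) * (u-v) * v^(N+1)‖ ≤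
      ((N+2 : ℕ) : ℝ)^2 * ‖u-v‖^2 * r^N := by
  have hr : 0 ≤ r := (norm_nonneg _).trans hu
  induction N with
  | zero =>
    have : u^(0+2) - v^(0+2) - ((0+2 : ℕ) : ℂ) * (u-v) * v^(0+1) = (u-v)^2 := by
      push_cast; ring
    rw [this, norm_pow]
    push_cast
    nlinarith [sq_nonneg ‖u-v‖]
  | succ N ih =>
    have : u^(N+1+2) - v^(N+1+2) - ((N+1+2 : ℕ) : ℂ) * (u-v) * v^(N+1+1) =
       u * (u^(N+2) - v^(N+2) - ((N+2 : ℕ) : ℂ) * (u-v) * v^(N+1)) +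
        ((N+2 : ℕ) : ℂ) * (u-v)^2 * v^(N+1) := by
      push_cast; ring
    rw [this]
    refine (norm_add_le _ _).trans ?_
    rw [norm_mul, norm_mul, norm_mul, norm_pow, norm_pow, Complex.norm_natCast]
    have h1 : ‖u‖ * ‖u^(N+2) - v^(N+2) - ((N+2 : ℕ) : ℂ) * (u-v) * v^(N+1)‖ ≤
      r * (((N+2 : ℕ) : ℝ)^2 * ‖u-v‖^2 * r^N) := by gcongr
    have h2 : ((N+2 : ℕ) : ℝ) * ‖u-v‖^2 * ‖v‖^(N+1) ≤ ((N+2 : ℕ) : ℝ) * ‖u-v‖^2 * r^(N+1) := by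
      gcongr
    refine (add_le_add h1 h2).trans ?_
    have h3 : 0 ≤ ‖u-v‖^2 * r^(N+1) := by positivity
    have h4 : (0:ℝ) ≤ N := Nat.cast_nonneg N
    have : r * (((N+2 : ℕ) : ℝ)^2 * ‖u-v‖^2 * r^N) + ((N+2 : ℕ) : ℝ) * ‖u-v‖^2 * r^(N+1) =
       (((N:ℝ)+2)^2 + (N+2)) * (‖u-v‖^2 * r^(N+1)) := by push_cast; ring
    rw [this]
    have : ((N+1+2 : ℕ) : ℝ)^2 * ‖u-v‖^2 * r^(N+1) = ((N:ℝ)+3)^2 * (‖u-v‖^2 * r^(N+1)) := by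
      push_cast; ring
    rw [this]
    exact mul_le_mul_of_nonneg_right (by nlinarith) h3

lemma exp_neg_taylor (x : ℝ) (hx : 0 ≤ x) : |Real.exp (-x) - (1 - x)| ≤ x^2 := by
  have h1 := Real.add_one_le_exp (-x)
  have h2 : Real.exp (-x) ≤ 1 / (1+x) := by
    rw [Real.exp_neg, inv_eq_one_div]
    apply one_div_le_one_div_of_le (by linarith)
    linarith [Real.add_one_le_exp x]
  have h3 : 1 / (1+x) ≤ 1 - x + x^2 := by
    rw [div_le_iff₀ (by linarith)]
    nlinarith [pow_nonneg hx 3]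
  rw [abs_le]; constructor <;> nlinarith

lemma lclt_ptwise (δ B : ℝ) (hδ : 0 < δ) (hB : 0 ≤ B) : ∃ C : ℝ, 0 ≤ C ∧
    ∀ (n : ℕ) (u : ℂ) (s θ : ℝ), 2 ≤ n → δ ≤ s/2 → s ≤ B → |θ| ≤ Real.pi →
      ‖u‖ ≤ Real.exp (-δ * θ^2) → |u.re - (1 - s*θ^2/2)| ≤ B * θ^4 → |u.im| ≤ B * |θ|^3 →
      |(u^n).re - Real.exp (-(n * (s/2)) * θ^2)| ≤ C / n * Real.exp (-(n*(δ/2)) * θ^2) := by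
  set D := B + B^2 with hD
  set E := 4 * D + B with hE
  have hD0 : 0 ≤ D := by positivity
  have hE0 : 0 ≤ E := by positivity
  set G := Real.exp (2 * δ * Real.pi^2) with hG
  have hG0 : 0 < G := Real.exp_pos _
  refine ⟨G * (D * (8/δ^2) + E^2 * (48/δ^3)), by positivity, ?_⟩
  intro n u s θ hn hs hsB hθ hu hre him
  obtain ⟨N, rfl⟩ : ∃ N, n = N + 2 := ⟨n - 2, by omega⟩
  set r := Real.exp (-δ * θ^2) with hr
  set v := Real.exp (-(s * θ^2/2)) with hv
  have hr0 : 0 < r := Real.exp_pos _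
  have hv0 : 0 < v := Real.exp_pos _
  have hvr : v ≤ r := Real.exp_le_exp.2 (by nlinarith [sq_nonneg θ])
  have hr1 : r ≤ 1 := Real.exp_le_one_iff.2 (by nlinarith [sq_nonneg θ])
  have hvpow : Real.exp (-(((N+2 : ℕ) : ℝ) * (s/2)) * θ^2) = v^(N+2) := by
    rw [hv, ← Real.exp_nat_mul]; congr 1; ring
  have hrev : |u.re - v| ≤ D * θ^4 := by
    have h1 := exp_neg_taylor (s * θ^2/2) (by nlinarith [sq_nonneg θ])
    have h2 : (s * θ^2/2)^2 ≤ B^2 * θ^4 := by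
      have : (s * θ^2/2)^2 = (s^2/4) * θ^4 := by ring
      rw [this]
      have : s^2 ≤ B^2 := by
        apply pow_le_pow_left₀ (by linarith) hsB
      gcongr
      nlinarith [sq_nonneg s]
    calc |u.re - v| = |(u.re - (1 - s*θ^2/2)) - (v - (1 - s*θ^2/2))| := by congr 1; ring
      _ ≤ |u.re - (1 - s*θ^2/2)| + |v - (1 - s*θ^2/2)| := abs_sub _ _
      _ ≤ B * θ^4 + B^2 * θ^4 := add_le_add hre (h1.trans h2)
      _ = D * θ^4 := by rw [hD]; ring
  have hθ4 : θ^4 = |θ| * |θ|^3 := by rw [← pow_succ', ← abs_pow, abs_of_nonneg (by positivity : (0:ℝ) ≤ θ^4)]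
  have huv : ‖u - (v:ℂ)‖ ≤ E * |θ|^3 := by
    have h1 := Complex.norm_le_abs_re_add_abs_im (u - (v:ℂ))
    simp only [Complex.sub_re, Complex.ofReal_re, Complex.sub_im, Complex.ofReal_im, sub_zero] at h1
    have h2 : D * θ^4 ≤ 4 * D * |θ|^3 := by
      rw [hθ4]
      have : |θ| ≤ 4 := hθ.trans Real.pi_le_four
      have h3 : |θ| * |θ|^3 ≤ 4 * |θ|^3 := by gcongr
      nlinarith
    calc _ ≤ _ := h1
      _ ≤ 4 * D * |θ|^3 + B * |θ|^3 := add_le_add (hrev.trans h2) him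
      _ = _ := by rw [hE]; ring
  have huv2 : ‖u - (v:ℂ)‖^2 ≤ E^2 * θ^6 := by
    calc _ ≤ (E * |θ|^3)^2 := by gcongr
      _ = E^2 * (|θ|^2)^3 := by ring
      _ = _ := by rw [sq_abs]; ring
  have hp := pow_taylor u v r hu (by rw [Complex.norm_real, Real.norm_of_nonneg hv0.le]; exact hvr) N
  have hre2 := (Complex.abs_re_le_norm _).trans hp
  have e1 : (u^(N+2) - (v:ℂ)^(N+2) - ((N+2 : ℕ) : ℂ) * (u-v) * (v:ℂ)^(N+1)).re =
      (u^(N+2)).re - v^(N+2) - ((N+2 : ℕ) : ℝ) * (u.re - v) * v^(N+1) := by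
    rw [Complex.sub_re, Complex.sub_re, ← Complex.ofReal_pow, ← Complex.ofReal_pow,
      Complex.ofReal_re, Complex.re_mul_ofReal, ← Complex.ofReal_natCast, Complex.re_ofReal_mul]
    simp
  rw [e1] at hre2
  rw [hvpow]
  set n : ℝ := ((N+2 : ℕ) : ℝ) with hn'
  have hn0 : 0 < n := by rw [hn']; positivity
  have hrN : r^N ≤ G * Real.exp (-δ * (n * θ^2)) := by
    rw [hr, hG, ← Real.exp_nat_mul, ← Real.exp_add]
    apply Real.exp_le_exp.2
    have : θ^2 ≤ Real.pi^2 := sq_le_sq' (abs_le.1 hθ).1 (abs_le.1 hθ).2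
    rw [hn']; push_cast
    nlinarith
  have hvN : v^(N+1) ≤ r^N := by
    calc v^(N+1) ≤ r^(N+1) := by gcongr
      _ = r^N * r := pow_succ _ _
      _ ≤ r^N * 1 := by gcongr
      _ = _ := mul_one _
  have hmain : |(u^(N+2)).re - v^(N+2)| ≤ (n * D * θ^4 + n^2 * E^2 * θ^6) * r^N := by
    calc |(u^(N+2)).re - v^(N+2)| = |((u^(N+2)).re - v^(N+2) - n * (u.re - v) * v^(N+1)) +
          n * (u.re - v) * v^(N+1)| := by congr 1; ring
      _ ≤ _ := abs_add_le _ _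
      _ ≤ n^2 * (E^2 * θ^6) * r^N + n * (D * θ^4) * r^N := by
        apply add_le_add
        · refine hre2.trans ?_
          gcongr
        · rw [abs_mul, abs_mul, abs_of_pos hn0, abs_of_pos (pow_pos hv0 _)]
          gcongr
      _ = _ := by ring
  refine hmain.trans ?_
  set t := n * θ^2 with ht
  have ht0 : 0 ≤ t := by positivity
  have hx0 : 0 ≤ δ * t / 2 := by positivity
  have k2 : (δ * t / 2)^2/2 ≤ Real.exp (δ * t / 2) := by
    have := Real.pow_div_factorial_le_exp _ hx0 2
    rwa [show ((Nat.factorial 2 : ℕ) : ℝ) = 2 by norm_num [Nat.factorial]] at this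
  have k3 : (δ * t / 2)^3/6 ≤ Real.exp (δ * t / 2) := by
    have := Real.pow_div_factorial_le_exp _ hx0 3
    rwa [show ((Nat.factorial 3 : ℕ) : ℝ) = 6 by norm_num [Nat.factorial]] at this
  set e := Real.exp (δ * t / 2) with he
  have he0 : 0 < e := Real.exp_pos _
  have t2 : t^2 ≤ 8/δ^2 * e := by
    calc t^2 = 8/δ^2 * ((δ*t/2)^2/2) := by field_simp; ring
      _ ≤ _ := by gcongr
  have t3 : t^3 ≤ 48/δ^3 * e := by
    calc t^3 = 48/δ^3 * ((δ*t/2)^3/6) := by field_simp; ring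
      _ ≤ _ := by gcongr
  have hee : e * Real.exp (-δ * t) = Real.exp (-(n*(δ/2)) * θ^2) := by
    rw [he, ← Real.exp_add]; congr 1; rw [ht]; ring
  calc (n * D * θ^4 + n^2 * E^2 * θ^6) * r^N
      ≤ (n * D * θ^4 + n^2 * E^2 * θ^6) * (G * Real.exp (-δ * t)) := by gcongr
    _ = G / n * (D * t^2 + E^2 * t^3) * Real.exp (-δ * t) := by rw [ht]; field_simp
    _ ≤ G / n * (D * (8/δ^2 * e) + E^2 * (48/δ^3 * e)) * Real.exp (-δ * t) := by gcongr
    _ = G * (D * (8/δ^2) + E^2 * (48/δ^3)) / n * (e * Real.exp (-δ * t)) := by ring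
    _ = _ := by rw [hee]

lemma lclt (δ B : ℝ) (hδ : 0 < δ) (hB : 0 ≤ B) : ∃ C : ℝ, 0 ≤ C ∧
    ∀ (n : ℕ) (h : ℝ → ℂ) (s : ℝ), 2 ≤ n → Continuous h → δ ≤ s/2 → s ≤ B →
      (∀ θ, |θ| ≤ Real.pi → ‖h θ‖ ≤ Real.exp (-δ * θ^2)) →
      (∀ θ, |(h θ).re - (1 - s*θ^2/2)| ≤ B * θ^4) → (∀ θ, |(h θ).im| ≤ B * |θ|^3) →
      |(∫ θ in (-Real.pi)..Real.pi, ((h θ)^n).re) - √(Real.pi / (n * (s/2)))| ≤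
        C / n * √(Real.pi / (n * (δ/2))) := by
  obtain ⟨C, hC, H⟩ := lclt_ptwise δ B hδ hB
  refine ⟨C + 2/δ, by positivity, ?_⟩
  intro n h s hn hcont hs hsB h1 h2 h3
  have hn0 : (0:ℝ) < n := by positivity
  have hs0 : 0 < s := by linarith
  rw [intervalIntegral.integral_of_le (by linarith [Real.pi_pos]),
    ← MeasureTheory.integral_indicator measurableSet_Ioc,
    ← integral_gaussian, ← integral_gaussian, ← MeasureTheory.integral_const_mul]
  have i1 : MeasureTheory.Integrable (fun x : ℝ => Real.exp (-(n * (s/2)) * x^2)) :=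
    integrable_exp_neg_mul_sq (by positivity)
  have i2 : MeasureTheory.Integrable (fun x : ℝ => Real.exp (-(n * (δ/2)) * x^2)) :=
    integrable_exp_neg_mul_sq (by positivity)
  have i3 : MeasureTheory.Integrable ((Set.Ioc (-Real.pi) Real.pi).indicator
      fun θ => ((h θ)^n).re) := by
    rw [MeasureTheory.integrable_indicator_iff measurableSet_Ioc]
    have : Continuous fun θ => ((h θ)^n).re := Complex.continuous_re.comp (hcont.pow n)
    exact (this.integrableOn_Icc).mono_set Set.Ioc_subset_Icc_self
  rw [← MeasureTheory.integral_sub i3 i1, ← Real.norm_eq_abs]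
  refine MeasureTheory.norm_integral_le_of_norm_le (i2.const_mul _) (Filter.Eventually.of_forall ?_)
  intro θ
  rw [Real.norm_eq_abs]
  have hpos := Real.exp_pos (-(n * (δ/2)) * θ^2)
  by_cases hθ : θ ∈ Set.Ioc (-Real.pi) Real.pi
  · rw [Set.indicator_of_mem hθ]
    have hθ' : |θ| ≤ Real.pi := abs_le.2 ⟨hθ.1.le, hθ.2⟩
    refine (H n (h θ) s θ hn hs hsB hθ' (h1 θ hθ') (h2 θ) (h3 θ)).trans ?_
    gcongr
    linarith [show 0 ≤ 2/δ by positivity]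
  · rw [Set.indicator_of_notMem hθ, zero_sub, abs_neg, abs_of_pos (Real.exp_pos _)]
    have hθ2 : 1 ≤ θ^2 := by
      by_contra hlt
      push Not at hlt
      have := abs_lt.1 ((sq_lt_one_iff_abs_lt_one θ).1 hlt)
      exact hθ ⟨by linarith [Real.pi_gt_three], by linarith [Real.pi_gt_three]⟩
    have e1 : Real.exp (-(n * (s/2)) * θ^2) ≤
       Real.exp (-(n*δ/2)) * Real.exp (-(n * (δ/2)) * θ^2) := by
      rw [← Real.exp_add]
      apply Real.exp_le_exp.2
      have a1 : n * δ * θ^2 ≤ n * (s/2) * θ^2 := by gcongr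
      have a2 : n * δ/2 * 1 ≤ n * δ/2 * θ^2 := by gcongr
      nlinarith
    have e2 : Real.exp (-(n*δ/2)) ≤ 2/δ/n := by
      rw [Real.exp_neg, div_div]
      rw [inv_le_comm₀ (Real.exp_pos _) (by positivity), inv_div]
      have := Real.add_one_le_exp (n*δ/2)
      linarith [mul_comm (n:ℝ) δ]
    calc _ ≤ _ := e1
      _ ≤ 2/δ/n * Real.exp (-(n * (δ/2)) * θ^2) := by gcongr
      _ ≤ _ := by
        gcongr
        linarith

lemma cos_taylor4 (x : ℝ) : |Real.cos x - (1 - x^2/2)| ≤ x^4 := by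
  have h4 : |x|^4 = x^4 := by rw [← abs_pow, abs_of_nonneg (by positivity : (0:ℝ) ≤ x^4)]
  rcases le_total |x| 1 with h | h
  · have := Real.cos_bound h
    rw [h4] at this
    have : 0 ≤ x^4 := by positivity
    linarith
  · have h1 := Real.one_sub_sq_div_two_le_cos (x := x)
    have h2 := Real.cos_le_one x
    have h3 : 1 ≤ x^2 := by rwa [one_le_sq_iff_one_le_abs]
    rw [abs_le]
    constructor <;> nlinarith

lemma sin_taylor3 (x : ℝ) : |Real.sin x - x| ≤ 2 * |x|^3 := by
  rcases le_total |x| 1 with h | h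
  · have h1 := Real.sin_bound h
    have h2 : |Real.sin x - x| ≤ |Real.sin x - (x - x^3/6)| + |x^3/6| := by
      calc _ = |(Real.sin x - (x - x^3/6)) - x^3/6| := by congr 1; ring
        _ ≤ _ := abs_sub _ _
    have h3 : |x^3/6| = |x|^3/6 := by rw [abs_div, abs_pow]; norm_num
    have h4 : |x|^5 ≤ |x|^3 := pow_le_pow_of_le_one (abs_nonneg _) h (by norm_num)
    have : 0 ≤ |x|^3 := by positivity
    nlinarith
  · have h1 : |Real.sin x - x| ≤ |Real.sin x| + |x| := abs_sub _ _
    have h2 := Real.abs_sin_le_one x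
    have h3 : |x|^1 ≤ |x|^3 := pow_le_pow_right₀ h (by norm_num)
    rw [pow_one] at h3
    linarith

section cf
variable (p : ℕ → ℝ) (μ s B4 : ℝ) (g : ℕ → ℝ) (h : ℝ → ℂ)

lemma cf_re (hp : ∀ i, 0 ≤ p i) (h0 : HasSum p 1)
    (h2 : HasSum (fun i => p i * ((i:ℝ) - μ)^2) s)
    (h4 : ∀ i, p i * ((i:ℝ) - μ)^4 ≤ g i) (hg : HasSum g B4)
    (hh : ∀ θ, HasSum (fun i => (p i : ℂ) * Complex.exp (((θ * ((i:ℝ)-μ) : ℝ) : ℂ) * Complex.I)) (h θ))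
    (θ : ℝ) : |(h θ).re - (1 - s*θ^2/2)| ≤ B4 * θ^4 := by
  have e1 := Complex.hasSum_re (hh θ)
  simp only [Complex.re_ofReal_mul, Complex.exp_ofReal_mul_I_re] at e1
  have e2 := e1.sub (h0.sub (h2.mul_right (θ^2/2)))
  rw [show s * (θ^2/2) = s*θ^2/2 by ring] at e2
  rw [← e2.tsum_eq, ← Real.norm_eq_abs]
  refine tsum_of_norm_bounded (hg.mul_right (θ^4)) fun i => ?_
  rw [Real.norm_eq_abs]
  have := cos_taylor4 (θ * ((i:ℝ)-μ))
  calc _ = |p i * (Real.cos (θ * ((i:ℝ)-μ)) - (1 - (θ * ((i:ℝ)-μ))^2/2))| := by congr 1; ring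
    _ = p i * |Real.cos (θ * ((i:ℝ)-μ)) - (1 - (θ * ((i:ℝ)-μ))^2/2)| := by
      rw [abs_mul, abs_of_nonneg (hp i)]
    _ ≤ p i * (θ * ((i:ℝ)-μ))^4 := mul_le_mul_of_nonneg_left this (hp i)
    _ = (p i * ((i:ℝ) - μ)^4) * θ^4 := by ring
    _ ≤ _ := mul_le_mul_of_nonneg_right (h4 i) (by positivity)

lemma cf_im (hp : ∀ i, 0 ≤ p i) (h0 : HasSum p 1)
    (h1 : HasSum (fun i => p i * ((i:ℝ) - μ)) 0)
    (h4 : ∀ i, p i * ((i:ℝ) - μ)^4 ≤ g i) (hg : HasSum g B4)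
    (hh : ∀ θ, HasSum (fun i => (p i : ℂ) * Complex.exp (((θ * ((i:ℝ)-μ) : ℝ) : ℂ) * Complex.I)) (h θ))
    (θ : ℝ) : |(h θ).im| ≤ (2 * (1 + B4)) * |θ|^3 := by
  have e1 := Complex.hasSum_im (hh θ)
  simp only [Complex.im_ofReal_mul, Complex.exp_ofReal_mul_I_im] at e1
  have e2 := e1.sub (h1.mul_right θ)
  rw [zero_mul, sub_zero] at e2
  rw [← e2.tsum_eq, ← Real.norm_eq_abs]
  have e3 := ((h0.add hg).mul_left 2).mul_right (|θ|^3)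
  refine tsum_of_norm_bounded e3 fun i => ?_
  rw [Real.norm_eq_abs]
  set y := (i:ℝ) - μ with hy
  have := sin_taylor3 (θ * y)
  have hy3 : |y|^3 ≤ 1 + y^4 := by
    have h4 : y^4 = |y|^4 := by rw [← abs_pow, abs_of_nonneg (by positivity : (0:ℝ) ≤ y^4)]
    rw [h4]
    rcases le_total |y| 1 with h | h
    · have := pow_le_one₀ (n := 3) (abs_nonneg y) h
      have : 0 ≤ |y|^4 := by positivity
      linarith
    · have := pow_le_pow_right₀ h (show 3 ≤ 4 by norm_num)
      linarith
  calc _ = |p i * (Real.sin (θ * y) - θ * y)| := by congr 1; ring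
    _ = p i * |Real.sin (θ * y) - θ * y| := by
      rw [abs_mul, abs_of_nonneg (hp i)]
    _ ≤ p i * (2 * |θ * y|^3) := mul_le_mul_of_nonneg_left this (hp i)
    _ = 2 * (p i * |y|^3) * |θ|^3 := by rw [abs_mul]; ring
    _ ≤ 2 * (p i * (1 + y^4)) * |θ|^3 := by
      have := mul_le_mul_of_nonneg_left hy3 (hp i)
      gcongr
    _ = 2 * (p i + p i * y^4) * |θ|^3 := by ring
    _ ≤ _ := by
      have := h4 i
      gcongr

lemma cf_var_le (hp : ∀ i, 0 ≤ p i) (h0 : HasSum p 1)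
    (h2 : HasSum (fun i => p i * ((i:ℝ) - μ)^2) s)
    (h4 : ∀ i, p i * ((i:ℝ) - μ)^4 ≤ g i) (hg : HasSum g B4) : s ≤ 1 + B4 := by
  refine hasSum_le (fun i => ?_) h2 (h0.add hg)
  refine le_trans ?_ (add_le_add le_rfl (h4 i))
  have := hp i
  have h : ((i:ℝ)-μ)^2 ≤ 1 + ((i:ℝ)-μ)^4 := by nlinarith [sq_nonneg (((i:ℝ)-μ)^2 - 1)]
  nlinarith

lemma cf_p23 (hp : ∀ i, 0 ≤ p i) (h0 : HasSum p 1) : p 2 + p 3 ≤ 1 := by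
  have := sum_le_hasSum {2,3} (fun i _ => hp i) h0
  simpa using this

lemma cf_var_ge (hp : ∀ i, 0 ≤ p i) (h0 : HasSum p 1)
    (h2 : HasSum (fun i => p i * ((i:ℝ) - μ)^2) s) : p 2 * p 3 / 2 ≤ s := by
  have h := sum_le_hasSum {2,3} (fun i _ => mul_nonneg (hp i) (sq_nonneg _)) h2
  have h23 := cf_p23 p hp h0
  rw [Finset.sum_pair (by norm_num)] at h
  simp only [Nat.cast_ofNat] at h
  refine le_trans ?_ h
  have a := hp 2
  have b := hp 3
  have c1 : p 2 * p 3 ≤ p 2 := by nlinarith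
  have c2 : p 2 * p 3 ≤ p 3 := by nlinarith
  have c0 : 0 ≤ p 2 * p 3 := by positivity
  have d1 : p 2 * p 3 * (2 - μ)^2 ≤ p 2 * (2-μ)^2 := by gcongr
  have d2 : p 2 * p 3 * (3 - μ)^2 ≤ p 3 * (3-μ)^2 := by gcongr
  have d3 : 1/2 ≤ (2-μ)^2 + (3-μ)^2 := by nlinarith [sq_nonneg (2*μ - 5)]
  nlinarith

lemma cf_norm (hp : ∀ i, 0 ≤ p i) (h0 : HasSum p 1)
    (hh : ∀ θ, HasSum (fun i => (p i : ℂ) * Complex.exp (((θ * ((i:ℝ)-μ) : ℝ) : ℂ) * Complex.I)) (h θ))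
    (θ : ℝ) (hθ : |θ| ≤ Real.pi) :
    ‖h θ‖ ≤ Real.exp (-(2/Real.pi^2 * (p 2 * p 3)) * θ^2) := by
  set F : ℕ → ℂ := fun i => (p i : ℂ) * Complex.exp (((θ * ((i:ℝ)-μ) : ℝ) : ℂ) * Complex.I) with hF
  have g1 : HasSum (fun i => if i ∈ ({2,3} : Finset ℕ) then F i else 0)
      (∑ i ∈ ({2,3} : Finset ℕ), if i ∈ ({2,3} : Finset ℕ) then F i else 0) :=
    hasSum_sum_of_ne_finset_zero (fun i hi => if_neg hi)
  have g2 : HasSum (fun i => if i ∈ ({2,3} : Finset ℕ) then p i else 0)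
      (∑ i ∈ ({2,3} : Finset ℕ), if i ∈ ({2,3} : Finset ℕ) then p i else 0) :=
    hasSum_sum_of_ne_finset_zero (fun i hi => if_neg hi)
  have k1 : (∑ i ∈ ({2,3} : Finset ℕ), if i ∈ ({2,3} : Finset ℕ) then F i else 0) = F 2 + F 3 := by
    simp
  have k2 : (∑ i ∈ ({2,3} : Finset ℕ), if i ∈ ({2,3} : Finset ℕ) then p i else 0) = p 2 + p 3 := by
    simp
  rw [k1] at g1
  rw [k2] at g2
  have d1 := (hh θ).sub g1
  have d2 := h0.sub g2
  have n1 : ‖h θ - (F 2 + F 3)‖ ≤ 1 - (p 2 + p 3) := by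
    rw [← d1.tsum_eq]
    refine tsum_of_norm_bounded d2 fun i => ?_
    by_cases hi : i ∈ ({2,3} : Finset ℕ)
    · simp only [hi, if_true, hF, sub_self, norm_zero, le_refl]
    · simp only [hi, if_false, sub_zero, norm_mul, Complex.norm_exp_ofReal_mul_I,
        Complex.norm_real, Real.norm_of_nonneg (hp i), mul_one, le_refl]
  have n2 : ‖F 2 + F 3‖ ≤ (p 2 + p 3) - p 2 * p 3 * (1 - Real.cos θ) := by
    have e : F 2 + F 3 = Complex.exp (((θ * (2-μ) : ℝ) : ℂ) * Complex.I) *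
        ((p 2 : ℂ) + p 3 * Complex.exp ((θ : ℂ) * Complex.I)) := by
      simp only [hF]
      rw [mul_add, ← mul_assoc, mul_comm _ (p 3 : ℂ), mul_assoc (p 3 : ℂ), ← Complex.exp_add,
        mul_comm _ (p 2 : ℂ)]
      congr 3
      push_cast
      ring_nf
    have a := hp 2
    have b := hp 3
    have h23 := cf_p23 p hp h0
    have c1 := Real.cos_le_one θ
    have c2 := Real.neg_one_le_cos θ
    rw [e, norm_mul, Complex.norm_exp_ofReal_mul_I, one_mul]
    have hnn : 0 ≤ (p 2 + p 3) - p 2 * p 3 * (1 - Real.cos θ) := by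
      have : p 2 * p 3 * (1 - Real.cos θ) ≤ p 2 * p 3 * 2 := by
        apply mul_le_mul_of_nonneg_left (by linarith) (by positivity)
      nlinarith
    refine abs_le_of_sq_le_sq' ?_ hnn |>.2
    rw [← Complex.normSq_eq_norm_sq, Complex.normSq_apply]
    simp only [Complex.add_re, Complex.ofReal_re, Complex.re_ofReal_mul,
      Complex.exp_ofReal_mul_I_re, Complex.add_im, Complex.ofReal_im, Complex.im_ofReal_mul,
      Complex.exp_ofReal_mul_I_im]
    set q := p 2 * p 3 * (1 - Real.cos θ) with hq
    have hq0 : 0 ≤ q := by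
      rw [hq]; apply mul_nonneg (by positivity) (by linarith)
    have sc := Real.sin_sq_add_cos_sq θ
    have : (p 2 + p 3 * Real.cos θ) * (p 2 + p 3 * Real.cos θ) +
       (0 + p 3 * Real.sin θ) * (0 + p 3 * Real.sin θ) = (p 2 + p 3)^2 - 2 * q := by
      rw [hq]; linear_combination (p 3)^2 * sc
    rw [this]
    nlinarith [mul_nonneg hq0 (by linarith : 0 ≤ 1 - (p 2 + p 3)), sq_nonneg q]
  have n3 : ‖h θ‖ ≤ 1 - p 2 * p 3 * (1 - Real.cos θ) := by
    calc ‖h θ‖ = ‖(h θ - (F 2 + F 3)) + (F 2 + F 3)‖ := by rw [sub_add_cancel]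
      _ ≤ _ := norm_add_le _ _
      _ ≤ _ := by linarith
  have hc := Real.cos_le_one_sub_mul_cos_sq hθ
  have hq : p 2 * p 3 * (2 / Real.pi^2 * θ^2) ≤ p 2 * p 3 * (1 - Real.cos θ) :=
    mul_le_mul_of_nonneg_left (by linarith) (mul_nonneg (hp 2) (hp 3))
  have := Real.add_one_le_exp (-(2/Real.pi^2 * (p 2 * p 3)) * θ^2)
  linarith

end cf

/-- Truncated Poisson weights. -/
noncomputable def tp (l : ℝ) (i : ℕ) : ℝ := if i < 2 then 0 else l^i / (Nat.factorial i : ℝ) / fEx l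

lemma hasSum_trunc {E : Type*} [NormedAddCommGroup E] {F : ℕ → E} {a : E} (h : HasSum F a) :
    HasSum (fun i => if i < 2 then 0 else F i) (a - (F 0 + F 1)) := by
  have g : HasSum (fun i => if i ∈ Finset.range 2 then F i else 0)
      (∑ i ∈ Finset.range 2, if i ∈ Finset.range 2 then F i else 0) :=
    hasSum_sum_of_ne_finset_zero (fun i hi => if_neg hi)
  have k : (∑ i ∈ Finset.range 2, if i ∈ Finset.range 2 then F i else 0) = F 0 + F 1 := by
    simp [Finset.sum_range_succ]
  rw [k] at g
  refine (h.sub g).congr_fun ?_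
  intro i
  by_cases hi : i < 2 <;> simp [hi]

lemma hasSum_rexp (l : ℝ) : HasSum (fun i : ℕ => l^i / (Nat.factorial i : ℝ)) (Real.exp l) := by
  rw [Real.exp_eq_exp_ℝ]; exact NormedSpace.expSeries_div_hasSum_exp l

lemma hasSum_cexp (l : ℂ) : HasSum (fun i : ℕ => l^i / (Nat.factorial i : ℂ)) (Complex.exp l) := by
  rw [Complex.exp_eq_exp_ℂ]; exact NormedSpace.expSeries_div_hasSum_exp l

lemma hasSum_m1 (l : ℝ) :
    HasSum (fun i : ℕ => l^i / (Nat.factorial i : ℝ) * i) (l * Real.exp l) := by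
  have h := (hasSum_nat_add_iff (f := fun i : ℕ => l^i / (Nat.factorial i : ℝ) * i)
    (g := l * Real.exp l) 1).1 (by
      refine ((hasSum_rexp l).mul_left l).congr_fun fun i => ?_
      rw [Nat.factorial_succ]
      push_cast
      field_simp
      ring)
  simpa using h

lemma hasSum_m2 (l : ℝ) :
    HasSum (fun i : ℕ => l^i / (Nat.factorial i : ℝ) * (i * (i - 1))) (l^2 * Real.exp l) := by
  have h := (hasSum_nat_add_iff (f := fun i : ℕ => l^i / (Nat.factorial i : ℝ) * (i * (i - 1)))
    (g := l^2 * Real.exp l) 2).1 (by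
      refine ((hasSum_rexp l).mul_left (l^2)).congr_fun fun i => ?_
      rw [Nat.factorial_succ, Nat.factorial_succ]
      push_cast
      field_simp
      ring)
  simpa [Finset.sum_range_succ] using h

lemma fEx_lower (l : ℝ) (hl : 0 < l) : l^2/2 ≤ fEx l := by
  have := Real.quadratic_le_exp_of_nonneg hl.le
  unfold fEx; linarith

lemma fEx_pos (l : ℝ) (hl : 0 < l) : 0 < fEx l :=
  lt_of_lt_of_le (by positivity) (fEx_lower l hl)

lemma psi_eq (l : ℝ) (hl : 0 < l) : psi l = l * (Real.exp l - 1) / fEx l := by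
  unfold psi fEx; rw [if_neg hl.ne']

lemma psi_le (l : ℝ) (hl : 0 < l) : psi l ≤ 2 + l := by
  rw [psi_eq l hl, div_le_iff₀ (fEx_pos l hl)]
  have := fEx_lower l hl
  have h2 : Real.exp l - 1 = fEx l + l := by unfold fEx; ring
  rw [h2]
  nlinarith

lemma le_psi (l : ℝ) (hl : 0 < l) : l ≤ psi l := by
  rw [psi_eq l hl, le_div_iff₀ (fEx_pos l hl)]
  have h2 : Real.exp l - 1 = fEx l + l := by unfold fEx; ring
  rw [h2]
  nlinarith

lemma mul_deriv_psi (l : ℝ) (hl : 0 < l) :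
    l * deriv psi l = l^2 * Real.exp l / fEx l + psi l - psi l ^ 2 := by
  have hf := fEx_pos l hl
  have h1 : HasDerivAt fEx (Real.exp l - 1) l := by
    have := ((Real.hasDerivAt_exp l).sub_const 1).fun_sub (hasDerivAt_id' l)
    exact this
  have h2 : HasDerivAt (fun x => x * (Real.exp x - 1)) (1 * (Real.exp l - 1) + l * Real.exp l) l :=
    (hasDerivAt_id' l).fun_mul ((Real.hasDerivAt_exp l).sub_const 1)
  have h3 := h2.fun_div h1 hf.ne'
  have h4 : psi =ᶠ[nhds l] fun x => x * (Real.exp x - 1) / fEx x := by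
    filter_upwards [lt_mem_nhds hl] with x hx
    exact psi_eq x hx
  rw [h4.deriv_eq, h3.deriv, psi_eq l hl]
  field_simp
  ring

lemma tp_nonneg (l : ℝ) (hl : 0 < l) (i : ℕ) : 0 ≤ tp l i := by
  unfold tp
  have := fEx_pos l hl
  split_ifs <;> positivity

lemma tp_hasSum (l : ℝ) (G : ℕ → ℝ) (a : ℝ)
    (h : HasSum (fun i : ℕ => l^i / (Nat.factorial i : ℝ) * G i) a) :
    HasSum (fun i => tp l i * G i) ((a - (G 0 + l * G 1)) / fEx l) := by
  have := (hasSum_trunc h).div_const (fEx l)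
  simp only [pow_zero, Nat.factorial, pow_one, Nat.cast_one, div_one, one_mul, mul_one] at this
  refine this.congr_fun fun i => ?_
  unfold tp
  split_ifs
  · simp
  · ring

lemma tp_h0 (l : ℝ) (hl : 0 < l) : HasSum (tp l) 1 := by
  have h := tp_hasSum l (fun _ => 1) (Real.exp l) (by simpa using hasSum_rexp l)
  have hf := fEx_pos l hl
  have e : (Real.exp l - (1 + l * 1)) / fEx l = 1 := by
    rw [div_eq_one_iff_eq hf.ne']; unfold fEx; ring
  rw [e] at h
  simpa using h

lemma tp_m1 (l : ℝ) (hl : 0 < l) : HasSum (fun i => tp l i * (i:ℝ)) (psi l) := by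
  have h := tp_hasSum l (fun i => (i:ℝ)) _ (hasSum_m1 l)
  rw [psi_eq l hl]
  convert h using 1
  congr 1
  push_cast
  ring

lemma tp_h1 (l : ℝ) (hl : 0 < l) : HasSum (fun i => tp l i * ((i:ℝ) - psi l)) 0 := by
  have h := (tp_m1 l hl).sub ((tp_h0 l hl).mul_right (psi l))
  rw [one_mul, sub_self] at h
  exact h.congr_fun fun i => by ring

lemma tp_h2 (l : ℝ) (hl : 0 < l) :
    HasSum (fun i => tp l i * ((i:ℝ) - psi l)^2) (l * deriv psi l) := by
  have h := tp_hasSum l (fun i => (i:ℝ) * (i - 1)) _ (hasSum_m2 l)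
  have h' := (h.add ((tp_m1 l hl).mul_right (1 - 2 * psi l))).add
    ((tp_h0 l hl).mul_right (psi l ^ 2))
  have e : l * deriv psi l = (l^2 * Real.exp l - (((0:ℕ):ℝ) * (((0:ℕ):ℝ) - 1) +
      l * (((1:ℕ):ℝ) * (((1:ℕ):ℝ) - 1)))) / fEx l + psi l * (1 - 2 * psi l) + 1 * psi l ^ 2 := by
    rw [mul_deriv_psi l hl]; push_cast; ring
  rw [e]
  exact h'.congr_fun fun i => by ring

lemma tp_h4 (l : ℝ) (hl : 0 < l) (i : ℕ) : tp l i * ((i:ℝ) - psi l)^4 ≤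
    8 * (24 * ((Real.exp 1 * l)^i / (Nat.factorial i : ℝ)) / fEx l + tp l i * psi l ^4) := by
  have hf := fEx_pos l hl
  have hp := tp_nonneg l hl i
  have h1 : ((i:ℝ) - psi l)^4 ≤ 8 * ((i:ℝ)^4 + psi l^4) := by
    have a1 : ((i:ℝ) - psi l)^2 ≤ 2 * ((i:ℝ)^2 + psi l^2) := by nlinarith [sq_nonneg ((i:ℝ) + psi l)]
    have a2 : (((i:ℝ) - psi l)^2)^2 ≤ (2 * ((i:ℝ)^2 + psi l^2))^2 :=
      pow_le_pow_left₀ (sq_nonneg _) a1 2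
    nlinarith [sq_nonneg ((i:ℝ)^2 - psi l^2)]
  have h2 : (i:ℝ)^4 ≤ 24 * Real.exp 1 ^ i := by
    have := Real.pow_div_factorial_le_exp (i:ℝ) (Nat.cast_nonneg i) 4
    rw [show ((Nat.factorial 4 : ℕ) : ℝ) = 24 by norm_num [Nat.factorial]] at this
    rw [← Real.exp_nat_mul, mul_one]
    linarith
  have h3 : tp l i ≤ l^i / (Nat.factorial i : ℝ) / fEx l := by
    unfold tp
    split_ifs
    · positivity
    · exact le_rfl
  calc tp l i * ((i:ℝ) - psi l)^4 ≤ tp l i * (8 * ((i:ℝ)^4 + psi l^4)) := by gcongr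
    _ = 8 * (tp l i * (i:ℝ)^4 + tp l i * psi l^4) := by ring
    _ ≤ 8 * (l^i / (Nat.factorial i : ℝ) / fEx l * (24 * Real.exp 1 ^ i) + tp l i * psi l^4) := by
      gcongr
    _ = _ := by rw [mul_pow]; ring

lemma tp_g4 (l : ℝ) (hl : 0 < l) : HasSum (fun i : ℕ =>
    8 * (24 * ((Real.exp 1 * l)^i / (Nat.factorial i : ℝ)) / fEx l + tp l i * psi l ^4))
    (8 * (24 * Real.exp (Real.exp 1 * l) / fEx l + psi l ^ 4)) := by
  have := ((((hasSum_rexp (Real.exp 1 * l)).mul_left 24).div_const (fEx l)).add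
    ((tp_h0 l hl).mul_right (psi l^4))).mul_left 8
  rwa [one_mul] at this

/-- Centered characteristic function. -/
noncomputable def hcf (l : ℝ) (θ : ℝ) : ℂ :=
  FD 0 (l * Complex.exp (θ * Complex.I)) / (fEx l : ℂ) *
    Complex.exp (-((θ * psi l : ℝ) : ℂ) * Complex.I)

lemma hcf_hasSum (l : ℝ) (θ : ℝ) :
    HasSum (fun i => (tp l i : ℂ) * Complex.exp (((θ * ((i:ℝ)-psi l) : ℝ) : ℂ) * Complex.I))
      (hcf l θ) := by
  have h := ((hasSum_trunc (hasSum_cexp (l * Complex.exp (θ * Complex.I)))).div_const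
    (fEx l : ℂ)).mul_right (Complex.exp (-((θ * psi l : ℝ) : ℂ) * Complex.I))
  simp only [pow_zero, Nat.factorial, pow_one, Nat.cast_one, div_one, mul_one] at h
  have e : hcf l θ = (Complex.exp (l * Complex.exp (θ * Complex.I)) -
      (1 + l * Complex.exp (θ * Complex.I))) / (fEx l : ℂ) *
      Complex.exp (-((θ * psi l : ℝ) : ℂ) * Complex.I) := by
    simp only [hcf, FD, if_true]
    ring
  rw [e]
  refine h.congr_fun fun i => ?_
  unfold tp
  split_ifs
  · simp
  · have : Complex.exp (((θ * ((i:ℝ)-psi l) : ℝ) : ℂ) * Complex.I) =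
      Complex.exp (θ * Complex.I)^i * Complex.exp (-((θ * psi l : ℝ) : ℂ) * Complex.I) := by
      rw [← Complex.exp_nat_mul, ← Complex.exp_add]
      congr 1
      push_cast
      ring
    rw [this]
    push_cast
    rw [mul_pow]
    ring

lemma hcf_cont (l : ℝ) : Continuous (hcf l) := by
  unfold hcf FD
  simp only [if_true]
  fun_prop

lemma chip_hcf (k m n : ℕ) (l : ℝ) (hl : 0 < l) (hn : 0 < n)
    (hpsi : psi l = k * (m:ℝ) / (n:ℝ)) :
    ((chipSet k m n).card : ℝ) * l ^ (k*m) / (Nat.factorial (k*m) : ℝ) =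
    fEx l ^ n * ((2 * Real.pi)⁻¹ * ∫ θ in (-Real.pi)..Real.pi, ((hcf l θ)^n).re) := by
  have h := chip_integral k m n l hl
  have hf := fEx_pos l hl
  have hfc : (fEx l : ℂ) ≠ 0 := by exact_mod_cast hf.ne'
  have hnc : (n:ℝ) ≠ 0 := by positivity
  have e : ∀ θ : ℝ, (FD 0 (l * Complex.exp (θ * Complex.I)))^n *
        Complex.exp (-(θ * Complex.I) * ((k*m : ℕ) : ℂ)) = (fEx l : ℂ)^n * (hcf l θ)^n := by
    intro θ
    unfold hcf
    rw [mul_pow, div_pow, ← Complex.exp_nat_mul]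
    have : -(θ * Complex.I) * ((k*m : ℕ) : ℂ) = n * (-((θ * psi l : ℝ) : ℂ) * Complex.I) := by
      have h1 : (n:ℝ) * psi l = ((k*m : ℕ) : ℝ) := by rw [hpsi]; push_cast; field_simp
      have h2 : (n:ℂ) * (psi l : ℂ) = ((k*m : ℕ) : ℂ) := by exact_mod_cast h1
      rw [← h2]
      push_cast
      ring
    rw [this]
    field_simp
  simp only [e] at h
  rw [intervalIntegral.integral_const_mul] at h
  have hre : (∫ θ in (-Real.pi)..Real.pi, ((hcf l θ)^n).re) =
      (∫ θ in (-Real.pi)..Real.pi, (hcf l θ)^n).re := by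
    have := Complex.reCLM.intervalIntegral_comp_comm (a := -Real.pi) (b := Real.pi)
      (μ := MeasureTheory.volume) (f := fun θ => (hcf l θ)^n)
      (((hcf_cont l).pow n).intervalIntegrable _ _)
    simpa using this
  rw [hre]
  have h' := congrArg Complex.re h
  have e1 : (((chipSet k m n).card : ℂ) * (l:ℂ) ^ (k*m) / (Nat.factorial (k*m) : ℂ)) =
     ((((chipSet k m n).card : ℝ) * l ^ (k*m) / (Nat.factorial (k*m) : ℝ) : ℝ) : ℂ) := by
    push_cast; rfl
  rw [e1, Complex.ofReal_re] at h'
  rw [h']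
  have e2 : (2 * (Real.pi : ℂ))⁻¹ * ((fEx l : ℂ)^n * ∫ θ in (-Real.pi)..Real.pi, (hcf l θ)^n) =
     (((2 * Real.pi)⁻¹ * fEx l ^ n : ℝ) : ℂ) * ∫ θ in (-Real.pi)..Real.pi, (hcf l θ)^n := by
    push_cast; ring
  rw [e2, Complex.re_ofReal_mul]
  ring

lemma chip_uniform (a b : ℝ) (ha : 0 < a) (hab : a ≤ b) : ∃ K : ℝ, ∀ (k m n : ℕ) (l : ℝ), 2 ≤ n →
    a ≤ l → l ≤ b → psi l = k * (m:ℝ) / (n:ℝ) →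
      |((chipSet k m n).card : ℝ) * l ^ (k * m) *
          Real.sqrt (2 * Real.pi * (n : ℝ) * l * deriv psi l) /
          ((Nat.factorial (k * m) : ℝ) * fEx l ^ n) - 1| ≤ K / (n : ℝ) := by
  have hb : 0 < b := ha.trans_le hab
  set q := a^5 / (12 * Real.exp b ^ 2) with hq
  have hq0 : 0 < q := by positivity
  set δ := 2 / Real.pi^2 * q with hδ
  have hpi := Real.pi_pos
  have hδ0 : 0 < δ := by positivity
  set B4 := 8 * (24 * Real.exp (Real.exp 1 * b) / (a^2/2) + (2+b)^4) with hB4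
  have hB40 : 0 ≤ B4 := by positivity
  set B := 2 * (1 + B4) with hB
  have hB0 : 0 ≤ B := by positivity
  obtain ⟨C, hC, H⟩ := lclt δ B hδ0 hB0
  refine ⟨C * √(B/δ), ?_⟩
  intro k m n l hn hal hlb hpsi
  have hl : 0 < l := ha.trans_le hal
  have hf := fEx_pos l hl
  have hn0 : (0:ℝ) < n := by positivity
  set s := l * deriv psi l with hs
  set B4' := 8 * (24 * Real.exp (Real.exp 1 * l) / fEx l + psi l ^ 4) with hB4'
  have hpsi0 : 0 ≤ psi l := hl.le.trans (le_psi l hl)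
  have hBB : B4' ≤ B4 := by
    have h1 : a^2/2 ≤ fEx l := le_trans (by gcongr) (fEx_lower l hl)
    have h2 : psi l ≤ 2 + b := (psi_le l hl).trans (by linarith)
    rw [hB4, hB4']
    gcongr
  have hqq : q ≤ tp l 2 * tp l 3 := by
    have e : tp l 2 * tp l 3 = l^5 / (12 * fEx l ^ 2) := by
      simp only [tp, Nat.factorial]
      norm_num
      field_simp
      norm_num
    rw [e, hq]
    have : fEx l ≤ Real.exp b := by
      have := Real.exp_le_exp.2 hlb
      unfold fEx; linarith
    gcongr
  have hp := tp_nonneg l hl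
  have c1 := cf_re (tp l) (psi l) s B4' _ (hcf l) hp (tp_h0 l hl) (tp_h2 l hl) (tp_h4 l hl)
    (tp_g4 l hl) (hcf_hasSum l)
  have c2 := cf_im (tp l) (psi l) B4' _ (hcf l) hp (tp_h0 l hl) (tp_h1 l hl) (tp_h4 l hl)
    (tp_g4 l hl) (hcf_hasSum l)
  have c3 := cf_var_le (tp l) (psi l) s B4' _ hp (tp_h0 l hl) (tp_h2 l hl) (tp_h4 l hl) (tp_g4 l hl)
  have c4 := cf_var_ge (tp l) (psi l) s hp (tp_h0 l hl) (tp_h2 l hl)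
  have c5 := cf_norm (tp l) (psi l) (hcf l) hp (tp_h0 l hl) (hcf_hasSum l)
  have hδs : δ ≤ s/2 := by
    have : 2 / Real.pi^2 ≤ 1/4 := by
      rw [div_le_div_iff₀ (by positivity) (by norm_num)]
      nlinarith [Real.pi_gt_three]
    have h1 : δ ≤ 1/4 * q := by rw [hδ]; gcongr
    linarith
  have hsB : s ≤ B := by rw [hB]; linarith
  have main := H n (hcf l) s hn (hcf_cont l) hδs hsB
    (fun θ hθ => (c5 θ hθ).trans (Real.exp_le_exp.2 (by
      have : δ * θ^2 ≤ 2 / Real.pi^2 * (tp l 2 * tp l 3) * θ^2 := by rw [hδ]; gcongr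
      linarith)))
    (fun θ => (c1 θ).trans (by gcongr; rw [hB]; linarith))
    (fun θ => (c2 θ).trans (by rw [hB]; gcongr))
  have hchip := chip_hcf k m n l hl (by omega) hpsi
  set J := ∫ θ in (-Real.pi)..Real.pi, ((hcf l θ)^n).re with hJ
  have hs0 : 0 < s := by linarith
  set S := √(2 * Real.pi * (n:ℝ) * l * deriv psi l) with hS
  have hS' : S = √(2 * Real.pi * n * s) := by rw [hS, hs]; congr 1; ring
  have hS0 : 0 ≤ S := Real.sqrt_nonneg _
  have hST : √(Real.pi / (n * (s/2))) * S = 2 * Real.pi := by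
    rw [hS', ← Real.sqrt_mul (by positivity)]
    rw [show Real.pi / (n * (s/2)) * (2 * Real.pi * n * s) = (2 * Real.pi)^2 by field_simp]
    exact Real.sqrt_sq (by positivity)
  have hSD : √(Real.pi / (n * (δ/2))) * S = 2 * Real.pi * √(s/δ) := by
    rw [hS', ← Real.sqrt_mul (by positivity)]
    rw [show Real.pi / (n * (δ/2)) * (2 * Real.pi * n * s) = (2 * Real.pi)^2 * (s/δ) by
      field_simp]
    rw [Real.sqrt_mul (by positivity), Real.sqrt_sq (by positivity)]
  have hfac : (Nat.factorial (k*m) : ℝ) ≠ 0 := by exact_mod_cast Nat.factorial_ne_zero _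
  have e1 : ((chipSet k m n).card : ℝ) * l ^ (k * m) * S /
          ((Nat.factorial (k * m) : ℝ) * fEx l ^ n) - 1 =
      (J - √(Real.pi / (n * (s/2)))) * S / (2 * Real.pi) := by
    have : ((chipSet k m n).card : ℝ) * l ^ (k * m) * S /
          ((Nat.factorial (k * m) : ℝ) * fEx l ^ n) =
       (((chipSet k m n).card : ℝ) * l ^ (k*m) / (Nat.factorial (k*m) : ℝ)) * S / fEx l ^ n := by
      field_simp
    rw [this, hchip, sub_mul, hST]
    field_simp
  rw [e1, abs_div, abs_mul, abs_of_nonneg hS0, abs_of_pos (by positivity : 0 < 2 * Real.pi)]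
  calc _ ≤ (C / n * √(Real.pi / (n * (δ/2)))) * S / (2 * Real.pi) := by gcongr
    _ = C / n * (√(Real.pi / (n * (δ/2))) * S) / (2 * Real.pi) := by ring
    _ = C / n * √(s/δ) := by rw [hSD]; field_simp
    _ ≤ C / n * √(B/δ) := by gcongr
    _ = _ := by ring

theorem card_chipSet_asymptotics
    (k : ℕ) (hk : 3 ≤ k) (m n : ℕ → ℕ)
    (hm : ∀ j, 0 < m j) (hn : ∀ j, 0 < n j)
    (hmtop : Filter.Tendsto m Filter.atTop Filter.atTop)
    (hntop : Filter.Tendsto n Filter.atTop Filter.atTop)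
    (c : ℝ) (hc : 2 / k < c)
    (hratio : Filter.Tendsto (fun j => (m j : ℝ) / (n j : ℝ)) Filter.atTop (nhds c))
    (lam : ℕ → ℝ) (hlam : ∀ j, 0 < lam j)
    (hroot : ∀ j, psi (lam j) = k * (m j : ℝ) / (n j : ℝ)) :
    ∃ K : ℝ, ∀ᶠ j in Filter.atTop,
      |((chipSet k (m j) (n j)).card : ℝ) * lam j ^ (k * m j) *
          Real.sqrt (2 * Real.pi * (n j : ℝ) * lam j * deriv psi (lam j)) /
          ((Nat.factorial (k * m j) : ℝ) * fEx (lam j) ^ (n j)) - 1|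
        ≤ K / (n j : ℝ) := by

  have hk0 : (0:ℝ) < k := by positivity
  have hkc : 2 < k * c := by
    rw [div_lt_iff₀ hk0] at hc
    linarith
  obtain ⟨K, hK⟩ := chip_uniform ((k*c-2)/2) (k*c+1) (by linarith) (by linarith)
  refine ⟨K, ?_⟩
  have ht : Filter.Tendsto (fun j => psi (lam j)) Filter.atTop (nhds (k*c)) := by
    have := hratio.const_mul (k:ℝ)
    refine this.congr fun j => ?_
    rw [hroot j]; ring
  filter_upwards [ht.eventually (lt_mem_nhds (show 2 + (k*c-2)/2 < k*c by linarith)),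
    ht.eventually (gt_mem_nhds (show k*c < k*c+1 by linarith)),
    hntop.eventually (Filter.eventually_ge_atTop 2)] with j h1 h2 h3
  have h4 := psi_le _ (hlam j)
  have h5 := le_psi _ (hlam j)
  exact hK k (m j) (n j) (lam j) h3 (by linarith) (by linarith) (hroot j)
end

section
/- Fix an integer k ≥ 3. Let (m_j) and (n_j) be sequences of positive integers tending to infinity with m_j/n_j → c ∈ (2/k, ∞); let λ = λ(ck) be the unique positive root of ψ(λ) = ck, let λ_j be the unique positive root of ψ(λ) = k m_j/n_j, and set γ = ((k−1)/2) · λ e^λ/(e^λ − 1). Then (k!)^{m_j} |A_{m_j,n_j}| · λ_j^{k m_j} · √(2π n_j λ_j ψ′(λ_j)) / ((k m_j)! · f(λ_j)^{n_j}) → e^{−γ}. In particular (k!)^{m_j}|A_{m_j,n_j}| / |C_{m_j,n_j}| → e^{−γ}, a limit bounded away from 0. -/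
open scoped Classical

/-- `A_{m,n}`: `m × n` 0–1 matrices with every row sum `k` and every column sum
at least `2` (encoded over `F₂`, counting entries equal to `1`). -/
noncomputable def constrainedSet (k m n : ℕ) : Finset (Matrix (Fin m) (Fin n) (ZMod 2)) :=
  Finset.univ.filter (fun A =>
    (∀ i : Fin m, (Finset.univ.filter (fun j : Fin n => A i j = 1)).card = k) ∧
    (∀ j : Fin n, 2 ≤ (Finset.univ.filter (fun i : Fin m => A i j = 1)).card))

noncomputable def TT : ℕ → ℂ → ℂ
  | 0 => fun z => Complex.exp z
  | (s+1) => fun z => TT s z - z ^ s / (Nat.factorial s : ℂ)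

lemma TT_hasDerivAt (s : ℕ) (z : ℂ) : HasDerivAt (TT s) (TT (s-1) z) z := by
  induction s with
  | zero => simpa [TT] using Complex.hasDerivAt_exp z
  | succ s ih =>
    have h1 : HasDerivAt (fun z : ℂ => z ^ s / (Nat.factorial s : ℂ))
        (((s : ℂ) * z ^ (s-1)) / (Nat.factorial s : ℂ)) z :=
      (hasDerivAt_pow s z).div_const _
    have h2 := ih.sub h1
    have e : TT (s+1) = TT s - fun z : ℂ => z ^ s / (Nat.factorial s : ℂ) := by
      funext w; simp [TT]
    rw [e]
    suffices key : TT (s + 1 - 1) z = TT (s - 1) z - (s : ℂ) * z ^ (s - 1) / (Nat.factorial s : ℂ) by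
      rw [key]; exact h2
    cases s with
    | zero => simp
    | succ s =>
      simp only [Nat.add_sub_cancel, TT]
      rw [Nat.factorial_succ]
      push_cast
      have : ((s:ℂ)+1) ≠ 0 := by exact_mod_cast Nat.succ_ne_zero s
      have h3 : ((s.factorial : ℕ) : ℂ) ≠ 0 := by exact_mod_cast Nat.factorial_ne_zero s
      field_simp

lemma TT_contDiff (s : ℕ) : ContDiff ℂ ⊤ (TT s) := by
  induction s with
  | zero => exact Complex.contDiff_exp
  | succ s ih =>
    have e : TT (s+1) = fun z => TT s z - z ^ s / (Nat.factorial s : ℂ) := by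
      funext w; simp [TT]
    rw [e]
    fun_prop

lemma TT_zero (s : ℕ) : TT s 0 = if s = 0 then 1 else 0 := by
  induction s with
  | zero => simp [TT]
  | succ s ih =>
    simp only [TT, ih]
    cases s <;> simp

lemma deriv_prodTT {n : ℕ} (s : Fin n → ℕ) :
    deriv (fun z => ∏ j, TT (s j) z) =
      fun z => ∑ i, ∏ j, TT (s j - if i = j then 1 else 0) z := by
  funext z
  have h := HasDerivAt.fun_finsetProd (u := Finset.univ) (f := fun j : Fin n => TT (s j))
    (f' := fun j => TT (s j - 1) z) (x := z) (fun j _ => TT_hasDerivAt (s j) z)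
  rw [h.deriv]
  refine Finset.sum_congr rfl fun i _ => ?_
  rw [← Finset.mul_prod_erase Finset.univ _ (Finset.mem_univ i)]
  rw [smul_eq_mul, mul_comm]
  simp only [if_true]
  congr 1
  refine Finset.prod_congr rfl fun j hj => ?_
  rw [if_neg (Finset.ne_of_mem_erase hj).symm]
  simp

lemma card_ext_fin {n : ℕ} (M : ℕ) : ∀ s : Fin n → ℕ,
    (((Finset.univ.filter (fun h : Fin M → Fin n =>
      ∀ j, s j ≤ (Finset.univ.filter (fun x => h x = j)).card)).card : ℕ) : ℂ) =
    iteratedDeriv M (fun z => ∏ j, TT (s j) z) 0 := by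
  induction M with
  | zero =>
    intro s
    simp only [iteratedDeriv_zero, TT_zero]
    simp only [Finset.card_filter, Finset.univ_eq_empty, Finset.sum_empty, Nat.le_zero]
    rw [Finset.prod_ite_zero]
    simp
  | succ M ih =>
    intro s
    rw [iteratedDeriv_succ', deriv_prodTT, iteratedDeriv_fun_sum]
    · rw [Finset.card_filter, ← Equiv.sum_comp (Fin.consEquiv (fun _ : Fin (M+1) => Fin n)),
        Fintype.sum_prod_type]
      push_cast
      refine Finset.sum_congr rfl fun i _ => ?_
      rw [← ih, Finset.card_filter]
      push_cast
      refine Finset.sum_congr rfl fun h _ => ?_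
      congr 1
      apply propext
      refine forall_congr' fun j => ?_
      rw [Finset.card_filter, Finset.card_filter, Fin.sum_univ_succ]
      simp only [Fin.consEquiv, Equiv.coe_fn_mk, Fin.cons_zero, Fin.cons_succ]
      split_ifs <;> omega
    · intro i _
      apply ContDiff.contDiffAt
      apply contDiff_prod
      intro j _
      exact (TT_contDiff _).of_le (by exact le_top)

lemma card_ext {n : ℕ} {α : Type} [Fintype α] [DecidableEq α] (s : Fin n → ℕ) :
    (((Finset.univ.filter (fun h : α → Fin n =>
      ∀ j, s j ≤ (Finset.univ.filter (fun x => h x = j)).card)).card : ℕ) : ℂ) =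
    iteratedDeriv (Fintype.card α) (fun z => ∏ j, TT (s j) z) 0 := by
  rw [← card_ext_fin]
  congr 1
  let e := Fintype.equivFin α
  refine Finset.card_bij (fun h _ => h ∘ e.symm) ?_ ?_ ?_
  · intro h hh
    simp only [Finset.mem_filter, Finset.mem_univ, true_and] at hh ⊢
    intro j
    refine (hh j).trans (le_of_eq ?_)
    exact Finset.card_bij (fun x _ => e x) (by simp) (by simp) (by
      intro b hb; exact ⟨e.symm b, by simpa using hb, by simp⟩)
  · intro a _ b _ h
    exact e.symm.surjective.injective_comp_right h
  · intro b hb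
    refine ⟨b ∘ e, ?_, by funext x; simp⟩
    simp only [Finset.mem_filter, Finset.mem_univ, true_and] at hb ⊢
    intro j
    refine (hb j).trans (le_of_eq ?_)
    exact Finset.card_bij (fun x _ => e.symm x) (by simp) (by simp) (by
      intro b hb; exact ⟨e b, by simpa using hb, by simp⟩)

section partB
open Filter Topology

lemma fEx_pos_s9 {x : ℝ} (hx : 0 < x) : 0 < fEx x := by
  have := Real.add_one_lt_exp hx.ne'
  unfold fEx; linarith

lemma psi_of_pos {x : ℝ} (hx : 0 < x) : psi x = x * (Real.exp x - 1) / fEx x := by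
  simp [psi, hx.ne', fEx]

noncomputable def sig (x : ℝ) : ℝ := psi x + x ^ 2 * Real.exp x / fEx x - psi x ^ 2

lemma sig_eq {x : ℝ} (hx : 0 < x) :
    sig x = x * ((Real.exp x - 1) ^ 2 - x ^ 2 * Real.exp x) / fEx x ^ 2 := by
  have h := (fEx_pos_s9 hx).ne'
  rw [sig, psi_of_pos hx]
  field_simp
  unfold fEx
  ring

lemma sig_pos {x : ℝ} (hx : 0 < x) : 0 < sig x := by
  rw [sig_eq hx]
  have hf := fEx_pos_s9 hx
  have h1 : x / 2 < Real.sinh (x / 2) := Real.self_lt_sinh_iff.2 (by linarith)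
  rw [Real.sinh_eq] at h1
  have he : Real.exp x = Real.exp (x/2) ^ 2 := by rw [← Real.exp_nat_mul]; congr 1; push_cast; ring
  have hp := Real.exp_pos (x/2)
  have hn : Real.exp (-(x/2)) * Real.exp (x/2) = 1 := by rw [← Real.exp_add]; simp
  have h2 : x * Real.exp (x/2) < Real.exp x - 1 := by
    rw [he]; nlinarith
  have h3 : 0 < (Real.exp x - 1) ^ 2 - x ^ 2 * Real.exp x := by
    have : (x * Real.exp (x/2))^2 < (Real.exp x - 1)^2 := by
      apply pow_lt_pow_left₀ h2 (by positivity) (by norm_num)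
    rw [mul_pow, ← he] at this
    linarith
  positivity

lemma psi_hasDerivAt {x : ℝ} (hx : 0 < x) : HasDerivAt psi (sig x / x) x := by
  have hf := (fEx_pos_s9 hx).ne'
  have h1 : HasDerivAt (fun x : ℝ => x * (Real.exp x - 1) / (Real.exp x - 1 - x))
      (((1 * (Real.exp x - 1) + x * (Real.exp x)) * (Real.exp x - 1 - x) -
        x * (Real.exp x - 1) * (Real.exp x - 1)) / (Real.exp x - 1 - x) ^ 2) x := by
    have ha : HasDerivAt (fun x : ℝ => Real.exp x - 1) (Real.exp x) x :=
      (Real.hasDerivAt_exp x).sub_const 1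
    exact ((hasDerivAt_id x).mul ha).div (ha.sub (hasDerivAt_id x)) hf
  have h2 : HasDerivAt psi (((1 * (Real.exp x - 1) + x * (Real.exp x)) * (Real.exp x - 1 - x) -
        x * (Real.exp x - 1) * (Real.exp x - 1)) / (Real.exp x - 1 - x) ^ 2) x := by
    refine h1.congr_of_eventuallyEq ?_
    filter_upwards [lt_mem_nhds hx] with y hy
    simp [psi, hy.ne']
  convert h2 using 1
  rw [sig_eq hx]
  have hf' : Real.exp x - 1 - x ≠ 0 := hf
  unfold fEx
  field_simp
  ring

lemma mul_deriv_psi_s9 {x : ℝ} (hx : 0 < x) : x * deriv psi x = sig x := by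
  rw [(psi_hasDerivAt hx).deriv]; field_simp

lemma psi_strictMonoOn : StrictMonoOn psi (Set.Ioi 0) := by
  apply strictMonoOn_of_deriv_pos (convex_Ioi 0)
  · intro x hx
    exact (psi_hasDerivAt hx).continuousAt.continuousWithinAt
  · intro x hx
    rw [interior_Ioi] at hx
    rw [(psi_hasDerivAt hx).deriv]
    exact div_pos (sig_pos hx) hx

lemma tendsto_lamj {l : ℕ → ℝ} {L : ℝ} (hL : 0 < L) (hl : ∀ j, 0 < l j)
    (h : Tendsto (fun j => psi (l j)) atTop (𝓝 (psi L))) : Tendsto l atTop (𝓝 L) := by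
  rw [tendsto_order]
  constructor
  · intro a ha
    have hb : 0 < max a (L/2) := lt_max_of_lt_right (by linarith)
    have hbL : max a (L/2) < L := max_lt ha (by linarith)
    have := psi_strictMonoOn (Set.mem_Ioi.2 hb) (Set.mem_Ioi.2 hL) hbL
    filter_upwards [h.eventually (lt_mem_nhds this)] with j hj
    exact lt_of_le_of_lt (le_max_left _ _)
      ((psi_strictMonoOn.lt_iff_lt (Set.mem_Ioi.2 hb) (Set.mem_Ioi.2 (hl j))).1 hj)
  · intro a ha
    have := psi_strictMonoOn (Set.mem_Ioi.2 hL) (Set.mem_Ioi.2 (hL.trans ha)) ha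
    filter_upwards [h.eventually (gt_mem_nhds this)] with j hj
    exact ((psi_strictMonoOn.lt_iff_lt (Set.mem_Ioi.2 (hl j)) (Set.mem_Ioi.2 (hL.trans ha))).1 hj)

lemma psi_continuousAt {x : ℝ} (hx : 0 < x) : ContinuousAt psi x :=
  (psi_hasDerivAt hx).continuousAt

lemma fEx_continuous : Continuous fEx := by unfold fEx; fun_prop

lemma sig_continuousAt {x : ℝ} (hx : 0 < x) : ContinuousAt sig x := by
  have h1 := psi_continuousAt hx
  have h2 := fEx_continuous.continuousAt (x := x)
  have h3 := (fEx_pos_s9 hx).ne'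
  unfold sig
  fun_prop (disch := assumption)

/-- Cauchy's formula on a circle centred at zero. -/
lemma cauchy_coeff {P : ℂ → ℂ} (hP : Differentiable ℂ P) {l : ℝ} (hl : 0 < l) (M : ℕ) :
    iteratedDeriv M P 0 / (Nat.factorial M : ℂ) * (l : ℂ) ^ M =
      (1 / (2 * Real.pi : ℝ) : ℂ) * ∫ θ in (-Real.pi)..Real.pi,
        P (l * Complex.exp (θ * Complex.I)) * Complex.exp (-(M * (θ * Complex.I))) := by
  have h := (hP.differentiableOn (s := Metric.closedBall 0 l)).circleIntegral_one_div_sub_center_pow_smul hl M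
  have hl' : (l : ℂ) ≠ 0 := by exact_mod_cast hl.ne'
  have hfac : ((Nat.factorial M : ℕ) : ℂ) ≠ 0 := by exact_mod_cast Nat.factorial_ne_zero M
  have hpi : (Real.pi : ℂ) ≠ 0 := by exact_mod_cast Real.pi_ne_zero
  have key : (∮ z in C(0, l), (1 / (z - 0) ^ (M + 1)) • P z) =
      Complex.I / (l:ℂ) ^ M * ∫ θ in (-Real.pi)..Real.pi,
        P (l * Complex.exp (θ * Complex.I)) * Complex.exp (-(M * (θ * Complex.I))) := by
    have hper : Function.Periodic (fun θ : ℝ => P (l * Complex.exp (θ * Complex.I)) *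
        Complex.exp (-(M * (θ * Complex.I)))) (2 * Real.pi) := by
      intro θ
      have e1 : Complex.exp (((θ + 2 * Real.pi : ℝ) : ℂ) * Complex.I) = Complex.exp (θ * Complex.I) := by
        push_cast
        rw [add_mul, Complex.exp_add, Complex.exp_two_pi_mul_I, mul_one]
      have e2 : ∀ w : ℂ, Complex.exp (-(M * w)) = (Complex.exp w)⁻¹ ^ M := by
        intro w
        rw [← Complex.exp_neg, ← Complex.exp_nat_mul]; congr 1; ring
      simp only [e2, e1]
    have hI := hper.intervalIntegral_add_eq (-Real.pi) 0
    have e3 : -Real.pi + 2 * Real.pi = Real.pi := by ring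
    rw [e3] at hI
    rw [hI, circleIntegral, ← intervalIntegral.integral_const_mul, zero_add]
    refine intervalIntegral.integral_congr fun θ _ => ?_
    simp only [deriv_circleMap, circleMap, zero_add, sub_zero, smul_eq_mul]
    have hE := Complex.exp_ne_zero (θ * Complex.I)
    have e2 : Complex.exp (-(M * (θ * Complex.I))) = (Complex.exp (θ * Complex.I))⁻¹ ^ M := by
        rw [← Complex.exp_neg, ← Complex.exp_nat_mul]; congr 1; ring
    rw [e2, inv_pow, mul_pow, pow_succ, pow_succ]
    field_simp
  rw [key] at h
  rw [smul_eq_mul] at h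
  have hI := Complex.I_ne_zero
  push_cast
  generalize (∫ θ in (-Real.pi)..Real.pi,
        P (l * Complex.exp (θ * Complex.I)) * Complex.exp (-(M * (θ * Complex.I)))) = J at h ⊢
  field_simp at h ⊢
  linear_combination -h

/-- rescaling. -/
lemma sqrt_rescale (F : ℝ → ℂ) (n : ℕ) (hn : 0 < n) :
    (Real.sqrt n : ℂ) * ∫ θ in (-Real.pi)..Real.pi, F θ =
      ∫ t : ℝ, (Set.Ioc (-(Real.pi * Real.sqrt n)) (Real.pi * Real.sqrt n)).indicator
        (fun t => F (t / Real.sqrt n)) t := by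
  have hs : 0 < Real.sqrt n := Real.sqrt_pos.2 (by exact_mod_cast hn)
  rw [MeasureTheory.integral_indicator measurableSet_Ioc,
    ← intervalIntegral.integral_of_le (by nlinarith [Real.pi_pos]),
    intervalIntegral.integral_comp_div (fun x => F x) hs.ne']
  rw [neg_div, mul_div_cancel_right₀ _ hs.ne']
  simp

end partB


section partB2
open Filter Topology Asymptotics

lemma tendsto_natsqrt_inv {n : ℕ → ℕ} (hn : Tendsto n atTop atTop) :
    Tendsto (fun j => ((Real.sqrt (n j) : ℝ) : ℂ)⁻¹) atTop (𝓝 0) := by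
  have h : Tendsto (fun j => (Real.sqrt (n j))⁻¹) atTop (𝓝 0) :=
    tendsto_inv_atTop_zero.comp
      (Real.tendsto_sqrt_atTop.comp (tendsto_natCast_atTop_atTop.comp hn))
  have := (Complex.continuous_ofReal.tendsto 0).comp h
  simpa [Function.comp_def] using this

lemma tendsto_zero_of_sqrt {n : ℕ → ℕ} (hn : Tendsto n atTop atTop) {w : ℕ → ℂ} {L : ℂ}
    (hw : Tendsto (fun j => ((Real.sqrt (n j) : ℝ) : ℂ) * w j) atTop (𝓝 L)) :
    Tendsto w atTop (𝓝 0) := by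
  have h := (tendsto_natsqrt_inv hn).mul hw
  rw [zero_mul] at h
  refine h.congr' ?_
  filter_upwards [hn.eventually_gt_atTop 0] with j hj
  have : ((Real.sqrt (n j) : ℝ) : ℂ) ≠ 0 := by
    exact_mod_cast (Real.sqrt_pos.2 (by exact_mod_cast hj : (0:ℝ) < n j)).ne'
  field_simp

lemma sqrt_sq_c (n : ℕ) : ((Real.sqrt n : ℝ) : ℂ) * ((Real.sqrt n : ℝ) : ℂ) = (n : ℂ) := by
  rw [← Complex.ofReal_mul, Real.mul_self_sqrt (by positivity)]; simp

lemma tendsto_exp_second {n : ℕ → ℕ} (hn : Tendsto n atTop atTop) {w : ℕ → ℂ} {L : ℂ}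
    (hw : Tendsto (fun j => ((Real.sqrt (n j) : ℝ) : ℂ) * w j) atTop (𝓝 L)) :
    Tendsto (fun j => (n j : ℂ) * (Complex.exp (w j) - 1 - w j)) atTop (𝓝 (L ^ 2 / 2)) := by
  have hw0 := tendsto_zero_of_sqrt hn hw
  have hwn : Tendsto (fun j => ‖w j‖) atTop (𝓝 0) := by simpa using hw0.norm
  have h1 : Tendsto (fun j => (((Real.sqrt (n j) : ℝ) : ℂ) * w j) ^ 2 / 2) atTop (𝓝 (L ^ 2 / 2)) :=
    (hw.pow 2).div_const 2
  have h2 : Tendsto (fun j => (n j : ℂ) * (Complex.exp (w j) - 1 - w j - (w j) ^ 2 / 2)) atTop (𝓝 0) := by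
    have hb : Tendsto (fun j => ‖((Real.sqrt (n j) : ℝ) : ℂ) * w j‖ ^ 2 * (‖w j‖ * Real.exp ‖w j‖))
        atTop (𝓝 (‖L‖ ^ 2 * (0 * Real.exp 0))) :=
      (hw.norm.pow 2).mul (hwn.mul ((Real.continuous_exp.tendsto 0).comp hwn))
    rw [zero_mul, mul_zero] at hb
    refine squeeze_zero_norm (fun j => ?_) hb
    have h3 := Complex.norm_exp_sub_sum_le_norm_mul_exp (w j) 3
    have e : Complex.exp (w j) - ∑ m ∈ Finset.range 3, w j ^ m / (m.factorial : ℂ) =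
        Complex.exp (w j) - 1 - w j - (w j) ^ 2 / 2 := by
      simp [Finset.sum_range_succ, Nat.factorial]; ring
    rw [e] at h3
    rw [norm_mul, norm_mul, mul_pow, Complex.norm_natCast]
    have e2 : ‖((Real.sqrt (n j) : ℝ) : ℂ)‖ ^ 2 = n j := by
      rw [← norm_pow, sq, sqrt_sq_c]; simp
    rw [e2]
    calc (n j : ℝ) * _ ≤ (n j : ℝ) * (‖w j‖ ^ 3 * Real.exp ‖w j‖) := by gcongr
      _ = _ := by ring
  have := h1.add h2
  rw [add_zero] at this
  refine this.congr fun j => ?_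
  rw [mul_pow, sq (((Real.sqrt (n j) : ℝ) : ℂ)), sqrt_sq_c]
  ring

lemma tendsto_pow_exp' {n : ℕ → ℕ} (hn : Tendsto n atTop atTop) {g : ℕ → ℂ} {t : ℂ}
    (hg : Tendsto (fun j => (n j : ℂ) * g j) atTop (𝓝 t)) :
    Tendsto (fun j => (1 + g j) ^ (n j)) atTop (𝓝 (Complex.exp t)) := by
  have hinv : Tendsto (fun j => ((n j : ℂ))⁻¹) atTop (𝓝 0) :=
    (tendsto_inv_atTop_nhds_zero_nat (𝕜 := ℂ)).comp hn
  have hg0 : Tendsto g atTop (𝓝 0) := by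
    have h := hinv.mul hg
    rw [zero_mul] at h
    refine h.congr' ?_
    filter_upwards [hn.eventually_gt_atTop 0] with j hj
    have : (n j : ℂ) ≠ 0 := by exact_mod_cast hj.ne'
    field_simp
  have hlog : Tendsto (fun j => (n j : ℂ) * Complex.log (1 + g j)) atTop (𝓝 t) := by
    apply hg.congr_dist
    refine IsBigO.trans_tendsto ?_ hinv
    simp_rw [dist_comm (_ * g _), dist_eq_norm, ← mul_sub, isBigO_norm_left]
    calc
      _ =O[atTop] fun j ↦ (n j : ℂ) * g j ^ 2 :=
        (isBigO_refl _ _).mul (Complex.log_sub_self_isBigO.comp_tendsto hg0)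
      _ =ᶠ[atTop] fun j ↦ ((n j : ℂ) * g j) ^ 2 * (n j : ℂ)⁻¹ := by
        filter_upwards [hn.eventually_gt_atTop 0] with j hj
        have : (n j : ℂ) ≠ 0 := by exact_mod_cast hj.ne'
        field_simp
      _ =O[atTop] _ := by
        simpa using isBigO_const_of_tendsto hg (one_ne_zero (α := ℂ))
          |>.pow 2 |>.mul (isBigO_refl _ _)
  refine ((Complex.continuous_exp.tendsto _).comp hlog).congr' ?_
  filter_upwards [hg0.eventually_ne (show (0:ℂ) ≠ -1 by simp)] with j hj
  have hne : 1 + g j ≠ 0 := by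
    intro h; apply hj; linear_combination h
  simp only [Function.comp]
  rw [Complex.exp_nat_mul, Complex.exp_log hne]

lemma TT_two (z : ℂ) : TT 2 z = Complex.exp z - 1 - z := by simp [TT]
lemma TT_one (z : ℂ) : TT 1 z = Complex.exp z - 1 := by simp [TT]
lemma TT_nul (z : ℂ) : TT 0 z = Complex.exp z := by simp [TT]

noncomputable def uu (l θ : ℝ) : ℂ := TT 2 (l * Complex.exp (θ * Complex.I)) / (fEx l : ℂ)

lemma tendsto_uu_second {n : ℕ → ℕ} (hn : Tendsto n atTop atTop) {l : ℕ → ℝ} {L : ℝ}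
    (hl : ∀ j, 0 < l j) (hL : 0 < L) (hlL : Tendsto l atTop (𝓝 L)) (t : ℝ) :
    Tendsto (fun j => (n j : ℂ) * (uu (l j) (t / Real.sqrt (n j)) *
      Complex.exp (-(psi (l j) * ((t / Real.sqrt (n j) : ℝ) * Complex.I))) - 1)) atTop
      (𝓝 (((-(sig L / 2) * t ^ 2 : ℝ)) : ℂ)) := by
  set x : ℕ → ℂ := fun j => ((t / Real.sqrt (n j) : ℝ) : ℂ) * Complex.I with hx
  have hsx : ∀ᶠ j in atTop, ((Real.sqrt (n j) : ℝ) : ℂ) * x j = t * Complex.I := by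
    filter_upwards [hn.eventually_gt_atTop 0] with j hj
    have : ((Real.sqrt (n j) : ℝ) : ℂ) ≠ 0 := by
      exact_mod_cast (Real.sqrt_pos.2 (by exact_mod_cast hj : (0:ℝ) < n j)).ne'
    simp only [hx]; push_cast; field_simp
  have h1 : Tendsto (fun j => ((Real.sqrt (n j) : ℝ) : ℂ) * x j) atTop (𝓝 (t * Complex.I)) :=
    tendsto_const_nhds.congr' (hsx.mono fun j h => h.symm)
  have hlc : Tendsto (fun j => (l j : ℂ)) atTop (𝓝 (L : ℂ)) :=
    (Complex.continuous_ofReal.tendsto L).comp hlL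
  have hpc : Tendsto (fun j => (psi (l j) : ℂ)) atTop (𝓝 (psi L : ℂ)) :=
    (Complex.continuous_ofReal.tendsto _).comp ((psi_continuousAt hL).tendsto.comp hlL)
  have hec : Tendsto (fun j => Complex.exp (l j : ℂ)) atTop (𝓝 (Complex.exp (L : ℂ))) :=
    (Complex.continuous_exp.tendsto _).comp hlc
  have hfc : Tendsto (fun j => (fEx (l j) : ℂ)) atTop (𝓝 (fEx L : ℂ)) :=
    (Complex.continuous_ofReal.tendsto _).comp ((fEx_continuous.tendsto L).comp hlL)
  have hfL : (fEx L : ℂ) ≠ 0 := by exact_mod_cast (fEx_pos_s9 hL).ne'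
  have heta := tendsto_exp_second hn h1
  have hx0 := tendsto_zero_of_sqrt hn h1
  set eta : ℕ → ℂ := fun j => Complex.exp (x j) - 1 - x j with heta_def
  -- delta
  have hdel : Tendsto (fun j => ((Real.sqrt (n j) : ℝ) : ℂ) * ((l j : ℂ) * (Complex.exp (x j) - 1)))
      atTop (𝓝 (L * (t * Complex.I))) := by
    have h2 : Tendsto (fun j => ((Real.sqrt (n j) : ℝ) : ℂ) * eta j) atTop (𝓝 0) := by
      have h3 := (tendsto_natsqrt_inv hn).mul heta
      rw [zero_mul] at h3
      refine h3.congr' ?_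
      filter_upwards [hn.eventually_gt_atTop 0] with j hj
      have : ((Real.sqrt (n j) : ℝ) : ℂ) ≠ 0 := by
        exact_mod_cast (Real.sqrt_pos.2 (by exact_mod_cast hj : (0:ℝ) < n j)).ne'
      rw [← sqrt_sq_c]
      field_simp
      rfl
    have h4 := hlc.mul (h1.add h2)
    rw [add_zero] at h4
    refine h4.congr fun j => ?_
    simp only [heta_def]; ring
  have heps := tendsto_exp_second hn hdel
  set del : ℕ → ℂ := fun j => (l j : ℂ) * (Complex.exp (x j) - 1) with hdel_def
  -- zeta
  have hz1 : Tendsto (fun j => ((Real.sqrt (n j) : ℝ) : ℂ) * (-(psi (l j) * x j)))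
      atTop (𝓝 (-(psi L * (t * Complex.I)))) := by
    refine (hpc.mul h1).neg.congr fun j => ?_
    ring
  have hzeta := tendsto_exp_second hn hz1
  set zeta : ℕ → ℂ := fun j => Complex.exp (-(psi (l j) * x j)) - 1 - (-(psi (l j) * x j)) with hzeta_def
  -- rho
  have hrho : Tendsto (fun j => (n j : ℂ) * (psi (l j) * eta j + Complex.exp (l j) / fEx (l j) *
      (Complex.exp (del j) - 1 - del j))) atTop
      (𝓝 (psi L * ((t * Complex.I) ^ 2 / 2) + Complex.exp L / fEx L * ((L * (t * Complex.I)) ^ 2 / 2))) := by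
    refine ((hpc.mul heta).add ((hec.div hfc hfL).mul heps)).congr fun j => ?_
    simp only [Pi.div_apply]
    ring
  set rho : ℕ → ℂ := fun j => psi (l j) * eta j + Complex.exp (l j) / fEx (l j) *
      (Complex.exp (del j) - 1 - del j) with hrho_def
  have hzz : Tendsto zeta atTop (𝓝 0) := by
    have hy : Tendsto (fun j => -((psi (l j) : ℂ) * x j)) atTop (𝓝 0) := by
      simpa using (hpc.mul hx0).neg
    have := (((Complex.continuous_exp.tendsto 0).comp hy).sub_const 1).sub hy
    simpa [hzeta_def, Function.comp_def] using this
  -- identity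
  have hid : ∀ j, uu (l j) (t / Real.sqrt (n j)) = 1 + psi (l j) * x j + rho j := by
    intro j
    have hf : (fEx (l j) : ℂ) ≠ 0 := by exact_mod_cast (fEx_pos_s9 (hl j)).ne'
    have hll : (l j : ℂ) ≠ 0 := by exact_mod_cast (hl j).ne'
    have e1 : (l j : ℂ) * Complex.exp (x j) = l j + del j := by simp only [hdel_def]; ring
    have e2 : (fEx (l j) : ℂ) = Complex.exp (l j) - 1 - l j := by simp [fEx]
    have e3 : (psi (l j) : ℂ) = l j * (Complex.exp (l j) - 1) / fEx (l j) := by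
      rw [psi_of_pos (hl j)]; push_cast; rfl
    have e4 : del j = l j * (x j + eta j) := by simp only [hdel_def, heta_def]; ring
    unfold uu
    change TT 2 (l j * Complex.exp (x j)) / _ = _
    rw [TT_two, e1, Complex.exp_add]
    simp only [hrho_def]
    rw [e3]
    field_simp
    rw [e2, e4]
    ring
  have hlim : Tendsto (fun j => (n j : ℂ) * rho j + (n j : ℂ) * zeta j
      - (((Real.sqrt (n j) : ℝ) : ℂ) * (-(psi (l j) * x j))) ^ 2
      + (psi (l j) * x j) * ((n j : ℂ) * zeta j) - (psi (l j) * x j) * ((n j : ℂ) * rho j)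
      + ((n j : ℂ) * rho j) * zeta j) atTop (𝓝 (
        (psi L * ((t * Complex.I) ^ 2 / 2) + Complex.exp L / fEx L * ((L * (t * Complex.I)) ^ 2 / 2))
        + (-(psi L * (t * Complex.I))) ^ 2 / 2 - (-(psi L * (t * Complex.I))) ^ 2
        + (psi L * 0) * ((-(psi L * (t * Complex.I))) ^ 2 / 2)
        - (psi L * 0) * (psi L * ((t * Complex.I) ^ 2 / 2) + Complex.exp L / fEx L * ((L * (t * Complex.I)) ^ 2 / 2))
        + (psi L * ((t * Complex.I) ^ 2 / 2) + Complex.exp L / fEx L * ((L * (t * Complex.I)) ^ 2 / 2)) * 0)) := by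
    exact ((((hrho.add hzeta).sub (hz1.pow 2)).add ((hpc.mul hx0).mul hzeta)).sub
      ((hpc.mul hx0).mul hrho)).add (hrho.mul hzz)
  have efin : ((psi L * ((t * Complex.I) ^ 2 / 2) + Complex.exp L / fEx L * ((L * (t * Complex.I)) ^ 2 / 2))
        + (-(psi L * (t * Complex.I))) ^ 2 / 2 - (-(psi L * (t * Complex.I))) ^ 2
        + (psi L * 0) * ((-(psi L * (t * Complex.I))) ^ 2 / 2)
        - (psi L * 0) * (psi L * ((t * Complex.I) ^ 2 / 2) + Complex.exp L / fEx L * ((L * (t * Complex.I)) ^ 2 / 2))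
        + (psi L * ((t * Complex.I) ^ 2 / 2) + Complex.exp L / fEx L * ((L * (t * Complex.I)) ^ 2 / 2)) * 0 : ℂ)
        = (((-(sig L / 2) * t ^ 2 : ℝ)) : ℂ) := by
    simp only [sig, mul_pow, Complex.I_sq, neg_sq]
    push_cast
    ring
  rw [efin] at hlim
  refine hlim.congr fun j => ?_
  rw [hid j]
  change _ = (n j : ℂ) * ((1 + psi (l j) * x j + rho j) * Complex.exp (-(psi (l j) * x j)) - 1)
  have e5 : Complex.exp (-(psi (l j) * x j)) = 1 - psi (l j) * x j + zeta j := by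
    simp only [hzeta_def]; ring
  rw [e5, ← sqrt_sq_c (n j)]
  ring

lemma norm_uu_le {l θ : ℝ} (hl : 0 < l) (hθ : |θ| ≤ Real.pi) :
    ‖uu l θ‖ ≤ Real.exp (-((2 / Real.pi ^ 2) * (l ^ 2 / 2 * (l ^ 3 / 6)) /
      ((l ^ 2 / 2 + l ^ 3 / 6) * fEx l)) * θ ^ 2) := by
  have hf := fEx_pos_s9 hl
  set z : ℂ := l * Complex.exp (θ * Complex.I) with hz
  have hzn : ‖z‖ = l := by
    rw [hz, norm_mul, Complex.norm_exp_ofReal_mul_I, mul_one, Complex.norm_real, Real.norm_of_nonneg hl.le]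
  have h3 := Complex.norm_exp_sub_sum_le_exp_norm_sub_sum z 4
  rw [hzn] at h3
  set A := l ^ 2 / 2 with hA
  set B := l ^ 3 / 6 with hB
  have hA0 : 0 < A := by positivity
  have hB0 : 0 < B := by positivity
  have e1 : Complex.exp z - ∑ m ∈ Finset.range 4, z ^ m / (m.factorial : ℂ) =
      TT 2 z - (z ^ 2 / 2 + z ^ 3 / 6) := by
    rw [TT_two]; simp [Finset.sum_range_succ, Nat.factorial]; ring
  have e2 : Real.exp l - ∑ m ∈ Finset.range 4, l ^ m / (m.factorial : ℝ) = fEx l - (A + B) := by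
    simp [Finset.sum_range_succ, Nat.factorial, fEx, hA, hB]; ring
  rw [e1, e2] at h3
  have h4 : ‖z ^ 2 / 2 + z ^ 3 / 6‖ = ‖(A : ℂ) + B * Complex.exp (θ * Complex.I)‖ := by
    have : z ^ 2 / 2 + z ^ 3 / 6 = Complex.exp (θ * Complex.I) ^ 2 * ((A : ℂ) + B * Complex.exp (θ * Complex.I)) := by
      rw [hz, hA, hB]; push_cast; ring
    rw [this, norm_mul, norm_pow, Complex.norm_exp_ofReal_mul_I, one_pow, one_mul]
  have h5 : ‖(A : ℂ) + B * Complex.exp (θ * Complex.I)‖ ^ 2 = (A + B) ^ 2 - 2 * (A * B) * (1 - Real.cos θ) := by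
    rw [Complex.exp_mul_I, ← Complex.ofReal_cos, ← Complex.ofReal_sin, ← Complex.normSq_eq_norm_sq,
      Complex.normSq_apply]
    simp [-Complex.ofReal_cos, -Complex.ofReal_sin]
    linear_combination B ^ 2 * Real.sin_sq_add_cos_sq θ
  have hc := Real.cos_le_one_sub_mul_cos_sq hθ
  have h6 : ‖(A : ℂ) + B * Complex.exp (θ * Complex.I)‖ ≤ (A + B) - A * B * (1 - Real.cos θ) / (A + B) := by
    have hc1 := Real.neg_one_le_cos θ
    have hc2 := Real.cos_le_one θ
    have hnn : 0 ≤ (A + B) - A * B * (1 - Real.cos θ) / (A + B) := by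
      rw [sub_nonneg, div_le_iff₀ (by positivity)]
      nlinarith [mul_pos hA0 hB0, sq_nonneg (A - B)]
    refine abs_le_of_sq_le_sq' ?_ hnn |>.2
    rw [h5]
    have : ((A + B) - A * B * (1 - Real.cos θ) / (A + B)) ^ 2 =
      (A + B) ^ 2 - 2 * (A * B) * (1 - Real.cos θ) + (A * B * (1 - Real.cos θ) / (A + B)) ^ 2 := by
      field_simp; ring
    rw [this]
    nlinarith [sq_nonneg (A * B * (1 - Real.cos θ) / (A + B))]
  have h7 : ‖TT 2 z‖ ≤ fEx l - A * B * (1 - Real.cos θ) / (A + B) := by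
    have := norm_add_le (TT 2 z - (z ^ 2 / 2 + z ^ 3 / 6)) (z ^ 2 / 2 + z ^ 3 / 6)
    rw [sub_add_cancel] at this
    linarith
  have h8 : ‖uu l θ‖ ≤ -((2 / Real.pi ^ 2) * (A * B) / ((A + B) * fEx l)) * θ ^ 2 + 1 := by
    unfold uu
    rw [norm_div, Complex.norm_real, Real.norm_of_nonneg hf.le, div_le_iff₀ hf]
    refine h7.trans ?_
    have h9 : A * B * (2 / Real.pi ^ 2 * θ ^ 2) / (A + B) ≤ A * B * (1 - Real.cos θ) / (A + B) := by
      gcongr; linarith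
    have : (-((2 / Real.pi ^ 2) * (A * B) / ((A + B) * fEx l)) * θ ^ 2 + 1) * fEx l =
      fEx l - A * B * (2 / Real.pi ^ 2 * θ ^ 2) / (A + B) := by
      field_simp; ring
    rw [this]; linarith
  exact h8.trans (Real.add_one_le_exp _)

end partB2


section partB3
open Filter Topology MeasureTheory

noncomputable def PP (n a b : ℕ) : ℂ → ℂ :=
  fun z => TT 2 z ^ (n - (a + b)) * TT 1 z ^ a * TT 0 z ^ b

lemma TT_differentiable (s : ℕ) : Differentiable ℂ (TT s) :=
  fun z => (TT_hasDerivAt s z).differentiableAt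

lemma PP_differentiable (n a b : ℕ) : Differentiable ℂ (PP n a b) := by
  unfold PP
  exact (((TT_differentiable 2).pow _).mul ((TT_differentiable 1).pow _)).mul
    ((TT_differentiable 0).pow _)

noncomputable def HH (a b s : ℕ) (l θ : ℝ) : ℂ :=
  Complex.exp (s * (θ * Complex.I)) * (l : ℂ) ^ s *
    (TT 1 (l * Complex.exp (θ * Complex.I)) / (fEx l : ℂ)) ^ a *
    (TT 0 (l * Complex.exp (θ * Complex.I)) / (fEx l : ℂ)) ^ b

noncomputable def kap (l : ℝ) : ℝ := (2 / Real.pi ^ 2) * (l ^ 2 / 2 * (l ^ 3 / 6)) /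
      ((l ^ 2 / 2 + l ^ 3 / 6) * fEx l)

lemma kap_pos {l : ℝ} (hl : 0 < l) : 0 < kap l := by
  have := fEx_pos_s9 hl
  have := Real.pi_pos
  unfold kap; positivity

lemma kap_continuousAt {l : ℝ} (hl : 0 < l) : ContinuousAt kap l := by
  have h1 := fEx_pos_s9 hl
  have h2 := fEx_continuous.continuousAt (x := l)
  have h3 : (l ^ 2 / 2 + l ^ 3 / 6) * fEx l ≠ 0 := by positivity
  unfold kap
  fun_prop (disch := assumption)

lemma norm_HH_le (a b s : ℕ) {l : ℝ} (hl : 0 < l) (θ : ℝ) :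
    ‖HH a b s l θ‖ ≤ l ^ s * ((Real.exp l + 1) / fEx l) ^ a * (Real.exp l / fEx l) ^ b := by
  have hf := fEx_pos_s9 hl
  have hzn : ‖(l * Complex.exp (θ * Complex.I) : ℂ)‖ = l := by
    rw [norm_mul, Complex.norm_exp_ofReal_mul_I, mul_one, Complex.norm_real, Real.norm_of_nonneg hl.le]
  have he := Complex.norm_exp_le_exp_norm (l * Complex.exp (θ * Complex.I) : ℂ)
  rw [hzn] at he
  have h1 : ‖TT 1 (l * Complex.exp (θ * Complex.I))‖ ≤ Real.exp l + 1 := by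
    rw [TT_one]
    refine (norm_sub_le _ _).trans ?_
    simpa using he
  have h0 : ‖TT 0 (l * Complex.exp (θ * Complex.I))‖ ≤ Real.exp l := by
    rw [TT_nul]; exact he
  have hs : ‖Complex.exp (s * (θ * Complex.I))‖ = 1 := by
    have := Complex.norm_exp_ofReal_mul_I (s * θ)
    push_cast at this
    rw [← mul_assoc]; exact this
  unfold HH
  rw [norm_mul, norm_mul, norm_mul, hs, one_mul, norm_pow, norm_pow, norm_pow, norm_div, norm_div,
    Complex.norm_real, Complex.norm_real, Real.norm_of_nonneg hl.le, Real.norm_of_nonneg hf.le]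
  gcongr

noncomputable def FF (a b s n N : ℕ) (l θ : ℝ) : ℂ :=
  uu l θ ^ (n - (a + b)) * Complex.exp (-(N * (θ * Complex.I))) * HH a b s l θ

lemma FF_continuous (a b s n N : ℕ) (l : ℝ) : Continuous (FF a b s n N l) := by
  have h2 := (TT_differentiable 2).continuous
  have h1 := (TT_differentiable 1).continuous
  have h0 := (TT_differentiable 0).continuous
  unfold FF HH uu
  fun_prop

lemma coeff_eq (a b s n N : ℕ) (hq : a + b ≤ n) (hs : s ≤ N) (hn : 0 < n) {l : ℝ} (hl : 0 < l) :
    iteratedDeriv (N - s) (PP n a b) 0 / (Nat.factorial (N - s) : ℂ) * (l : ℂ) ^ N /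
      (fEx l : ℂ) ^ n * ((Real.sqrt n : ℝ) : ℂ) =
    (1 / (2 * Real.pi : ℝ) : ℂ) *
      ∫ t : ℝ, (Set.Ioc (-(Real.pi * Real.sqrt n)) (Real.pi * Real.sqrt n)).indicator
        (fun t => FF a b s n N l (t / Real.sqrt n)) t := by
  have h := cauchy_coeff (PP_differentiable n a b) hl (N - s)
  rw [← sqrt_rescale _ n hn]
  have hf : (fEx l : ℂ) ≠ 0 := by exact_mod_cast (fEx_pos_s9 hl).ne'
  have e : ∀ θ : ℝ, FF a b s n N l θ = (l : ℂ) ^ s / (fEx l : ℂ) ^ n *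
      (PP n a b (l * Complex.exp (θ * Complex.I)) * Complex.exp (-(((N - s : ℕ) : ℂ) * (θ * Complex.I)))) := by
    intro θ
    unfold FF PP HH uu
    have e1 : Complex.exp (-(((N - s : ℕ) : ℂ) * (θ * Complex.I))) =
        Complex.exp (-(N * (θ * Complex.I))) * Complex.exp (s * (θ * Complex.I)) := by
      rw [← Complex.exp_add]; congr 1; push_cast [hs]; ring
    have e2 : (fEx l : ℂ) ^ n = (fEx l : ℂ) ^ (n - (a + b)) * (fEx l : ℂ) ^ a * (fEx l : ℂ) ^ b := by
      rw [← pow_add, ← pow_add]; congr 1; omega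
    rw [e1, e2, div_pow, div_pow, div_pow]
    field_simp
  have e3 : (l : ℂ) ^ N = (l : ℂ) ^ (N - s) * (l : ℂ) ^ s := by
    rw [← pow_add]; congr 1; omega
  simp_rw [e]
  rw [intervalIntegral.integral_const_mul, e3]
  linear_combination ((l : ℂ) ^ s / (fEx l : ℂ) ^ n * ((Real.sqrt n : ℝ) : ℂ)) * h

lemma llt {n N : ℕ → ℕ} (hn : Tendsto n atTop atTop) {l : ℕ → ℝ} {L : ℝ}
    (hl : ∀ j, 0 < l j) (hL : 0 < L) (hlL : Tendsto l atTop (𝓝 L))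
    (hN : ∀ j, psi (l j) * n j = N j) (a b s : ℕ) (hs : ∀ᶠ j in atTop, s ≤ N j) :
    Tendsto (fun j => iteratedDeriv (N j - s) (PP (n j) a b) 0 / (Nat.factorial (N j - s) : ℂ) *
      (l j : ℂ) ^ N j / (fEx (l j) : ℂ) ^ n j * ((Real.sqrt (n j) : ℝ) : ℂ)) atTop
      (𝓝 ((L ^ s * ((Real.exp L - 1) / fEx L) ^ a * (Real.exp L / fEx L) ^ b /
        Real.sqrt (2 * Real.pi * sig L) : ℝ) : ℂ)) := by
  have hsig := sig_pos hL
  have hpi := Real.pi_pos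
  set Hinf : ℝ := L ^ s * ((Real.exp L - 1) / fEx L) ^ a * (Real.exp L / fEx L) ^ b with hHinf
  have hfLc : (fEx L : ℂ) ≠ 0 := by exact_mod_cast (fEx_pos_s9 hL).ne'
  have hlc : Tendsto (fun j => (l j : ℂ)) atTop (𝓝 (L : ℂ)) :=
    (Complex.continuous_ofReal.tendsto L).comp hlL
  have hfc : Tendsto (fun j => (fEx (l j) : ℂ)) atTop (𝓝 (fEx L : ℂ)) :=
    (Complex.continuous_ofReal.tendsto _).comp ((fEx_continuous.tendsto L).comp hlL)
  have hpc : Tendsto (fun j => (psi (l j) : ℂ)) atTop (𝓝 (psi L : ℂ)) :=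
    (Complex.continuous_ofReal.tendsto _).comp ((psi_continuousAt hL).tendsto.comp hlL)
  have hnq : Tendsto (fun j => n j - (a + b)) atTop atTop :=
    (tendsto_sub_atTop_nat (a + b)).comp hn
  -- pointwise limit
  have hpt : ∀ t : ℝ, Tendsto (fun j => FF a b s (n j) (N j) (l j) (t / Real.sqrt (n j))) atTop
      (𝓝 (((Real.exp (-(sig L / 2) * t ^ 2) * Hinf : ℝ)) : ℂ)) := by
    intro t
    set x : ℕ → ℂ := fun j => ((t / Real.sqrt (n j) : ℝ) : ℂ) * Complex.I with hx
    have hx0 : Tendsto x atTop (𝓝 0) := by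
      have := ((tendsto_natsqrt_inv hn).const_mul (t : ℂ)).mul_const Complex.I
      simp only [mul_zero, zero_mul] at this
      refine this.congr fun j => ?_
      simp only [hx]; push_cast; ring
    have h1 := tendsto_uu_second hn hl hL hlL t
    set g : ℕ → ℂ := fun j => uu (l j) (t / Real.sqrt (n j)) *
      Complex.exp (-(psi (l j) * x j)) - 1 with hg
    have h1' : Tendsto (fun j => (n j : ℂ) * g j) atTop (𝓝 (((-(sig L / 2) * t ^ 2 : ℝ)) : ℂ)) := h1
    have hg0 : Tendsto g atTop (𝓝 0) := by
      have h := ((tendsto_inv_atTop_nhds_zero_nat (𝕜 := ℂ)).comp hn).mul h1'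
      rw [zero_mul] at h
      refine h.congr' ?_
      filter_upwards [hn.eventually_gt_atTop 0] with j hj
      have : (n j : ℂ) ≠ 0 := by exact_mod_cast hj.ne'
      simp only [Function.comp]
      field_simp
    have h2 : Tendsto (fun j => ((n j - (a + b) : ℕ) : ℂ) * g j) atTop
        (𝓝 (((-(sig L / 2) * t ^ 2 : ℝ)) : ℂ)) := by
      have := h1'.sub (hg0.const_mul ((a + b : ℕ) : ℂ))
      rw [mul_zero, sub_zero] at this
      refine this.congr' ?_
      filter_upwards [hn.eventually_ge_atTop (a + b)] with j hj
      rw [Nat.cast_sub hj]; ring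
    have h3 := tendsto_pow_exp' hnq h2
    have h4 : Tendsto (fun j => Complex.exp (-(psi (l j) * x j)) ^ (a + b)) atTop (𝓝 1) := by
      have hy : Tendsto (fun j => -((psi (l j) : ℂ) * x j)) atTop (𝓝 0) := by
        simpa using (hpc.mul hx0).neg
      have := ((Complex.continuous_exp.tendsto 0).comp hy).pow (a + b)
      simpa [Function.comp_def] using this
    have hex : Tendsto (fun j => Complex.exp (x j)) atTop (𝓝 1) := by
      have := (Complex.continuous_exp.tendsto 0).comp hx0
      simpa [Function.comp_def] using this
    have hz : Tendsto (fun j => (l j : ℂ) * Complex.exp (x j)) atTop (𝓝 (L : ℂ)) := by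
      simpa using hlc.mul hex
    have h5 : Tendsto (fun j => HH a b s (l j) (t / Real.sqrt (n j))) atTop (𝓝 (Hinf : ℂ)) := by
      have hes : Tendsto (fun j => Complex.exp (s * x j)) atTop (𝓝 1) := by
        have hy : Tendsto (fun j => (s : ℂ) * x j) atTop (𝓝 0) := by
          simpa using hx0.const_mul (s : ℂ)
        have := (Complex.continuous_exp.tendsto 0).comp hy
        simpa [Function.comp_def] using this
      have ha := ((((TT_differentiable 1).continuous.tendsto L).comp hz).div hfc hfLc).pow a
      have hb := ((((TT_differentiable 0).continuous.tendsto L).comp hz).div hfc hfLc).pow b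
      have := ((hes.mul (hlc.pow s)).mul ha).mul hb
      have e : (1 * (L : ℂ) ^ s * (TT 1 L / fEx L) ^ a * (TT 0 L / fEx L) ^ b) = (Hinf : ℂ) := by
        rw [hHinf, TT_one, TT_nul]; push_cast; ring
      rw [e] at this
      exact this
    have h6 := (h3.mul h4).mul h5
    have e6 : Complex.exp ((-(sig L / 2) * t ^ 2 : ℝ) : ℂ) * 1 * (Hinf : ℂ) =
      (((Real.exp (-(sig L / 2) * t ^ 2) * Hinf : ℝ)) : ℂ) := by push_cast; ring
    rw [e6] at h6
    refine h6.congr' ?_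
    filter_upwards [hn.eventually_ge_atTop (a + b)] with j hj
    unfold FF
    congr 1
    have e7 : (1 + g j) = uu (l j) (t / Real.sqrt (n j)) * Complex.exp (-(psi (l j) * x j)) := by
      simp only [hg]; ring
    rw [e7, mul_pow, mul_assoc, ← pow_add, Nat.sub_add_cancel hj, ← Complex.exp_nat_mul]
    congr 2
    have : (N j : ℂ) = psi (l j) * n j := by exact_mod_cast (hN j).symm
    change _ = -((N j : ℂ) * x j)
    rw [this]; ring
  -- dominating constants
  obtain ⟨C, hC⟩ : ∃ C : ℝ, ∀ᶠ j in atTop,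
      l j ^ s * ((Real.exp (l j) + 1) / fEx (l j)) ^ a * (Real.exp (l j) / fEx (l j)) ^ b ≤ C := by
    have hfr : Tendsto (fun j => fEx (l j)) atTop (𝓝 (fEx L)) := (fEx_continuous.tendsto L).comp hlL
    have her : Tendsto (fun j => Real.exp (l j)) atTop (𝓝 (Real.exp L)) :=
      (Real.continuous_exp.tendsto L).comp hlL
    have := ((hlL.pow s).mul (((her.add_const 1).div hfr (fEx_pos_s9 hL).ne').pow a)).mul
      ((her.div hfr (fEx_pos_s9 hL).ne').pow b)
    exact ⟨_, (this.eventually (gt_mem_nhds (lt_add_one _))).mono fun j hj => le_of_lt hj⟩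
  have hkap : ∀ᶠ j in atTop, kap L / 2 ≤ kap (l j) := by
    have := (kap_continuousAt hL).tendsto.comp hlL
    exact (this.eventually (lt_mem_nhds (half_lt_self (kap_pos hL)))).mono fun j hj => hj.le
  have hkL := kap_pos hL
  have hC0 : 0 ≤ C := by
    obtain ⟨j, hj⟩ := hC.exists
    refine le_trans ?_ hj
    have := fEx_pos_s9 (hl j)
    have := hl j
    positivity
  have hdom : Tendsto (fun j => ∫ t : ℝ, (Set.Ioc (-(Real.pi * Real.sqrt (n j)))
      (Real.pi * Real.sqrt (n j))).indicator
        (fun t => FF a b s (n j) (N j) (l j) (t / Real.sqrt (n j))) t) atTop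
      (𝓝 (∫ t : ℝ, (((Real.exp (-(sig L / 2) * t ^ 2) * Hinf : ℝ)) : ℂ))) := by
    refine tendsto_integral_filter_of_dominated_convergence
      (fun t => Real.exp (-(kap L / 4) * t ^ 2) * C) ?_ ?_ ?_ ?_
    · refine Eventually.of_forall fun j => ?_
      refine AEStronglyMeasurable.indicator ?_ measurableSet_Ioc
      exact ((FF_continuous _ _ _ _ _ _).comp (continuous_id.div_const _)).aestronglyMeasurable
    · filter_upwards [hC, hkap, hn.eventually_ge_atTop (2 * (a + b)), hn.eventually_gt_atTop 0]
        with j hCj hkj hnj hn0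
      refine Eventually.of_forall fun t => ?_
      have hsn : 0 < Real.sqrt (n j) := Real.sqrt_pos.2 (by exact_mod_cast hn0)
      by_cases ht : t ∈ Set.Ioc (-(Real.pi * Real.sqrt (n j))) (Real.pi * Real.sqrt (n j))
      · rw [Set.indicator_of_mem ht]
        have hth : |t / Real.sqrt (n j)| ≤ Real.pi := by
          rw [abs_div, abs_of_pos hsn, div_le_iff₀ hsn, abs_le]
          exact ⟨ht.1.le, ht.2⟩
        have hu := norm_uu_le (hl j) hth
        unfold FF
        have hN1 : ‖Complex.exp (-(N j * ((t / Real.sqrt (n j) : ℝ) * Complex.I)))‖ = 1 := by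
          have := Complex.norm_exp_ofReal_mul_I (-(N j * (t / Real.sqrt (n j))))
          rw [← this]; congr 2; push_cast; ring
        rw [norm_mul, norm_mul, hN1, mul_one, norm_pow]
        refine mul_le_mul ?_ ((norm_HH_le a b s (hl j) _).trans hCj) (norm_nonneg _) (Real.exp_pos _).le
        calc ‖uu (l j) (t / Real.sqrt (n j))‖ ^ (n j - (a + b))
            ≤ (Real.exp (-(kap (l j)) * (t / Real.sqrt (n j)) ^ 2)) ^ (n j - (a + b)) := by
              gcongr; exact hu
          _ = Real.exp (((n j - (a + b) : ℕ) : ℝ) * (-(kap (l j)) * (t / Real.sqrt (n j)) ^ 2)) := by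
              rw [Real.exp_nat_mul]
          _ ≤ _ := by
              apply Real.exp_le_exp.2
              rw [div_pow, Real.sq_sqrt (by positivity)]
              have hn0' : (0 : ℝ) < n j := by exact_mod_cast hn0
              have h2 : (n j : ℝ) / 2 ≤ ((n j - (a + b) : ℕ) : ℝ) := by
                rw [Nat.cast_sub (by omega)]
                have : (2 * (a + b) : ℝ) ≤ n j := by exact_mod_cast hnj
                push_cast
                linarith
              have h3 : (n j : ℝ) / 2 * (kap L / 2 * (t ^ 2 / n j)) ≤
                ((n j - (a + b) : ℕ) : ℝ) * (kap (l j) * (t ^ 2 / n j)) := by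
                gcongr
              have h4 : (n j : ℝ) / 2 * (kap L / 2 * (t ^ 2 / n j)) = kap L / 4 * t ^ 2 := by
                field_simp; ring
              linarith
      · rw [Set.indicator_of_notMem ht, norm_zero]
        positivity
    · exact (integrable_exp_neg_mul_sq (by linarith)).mul_const C
    · refine Eventually.of_forall fun t => ?_
      refine (hpt t).congr' ?_
      have hlarge : Tendsto (fun j => Real.pi * Real.sqrt (n j)) atTop atTop :=
        Tendsto.const_mul_atTop hpi
          (Real.tendsto_sqrt_atTop.comp (tendsto_natCast_atTop_atTop.comp hn))
      filter_upwards [hlarge.eventually_gt_atTop |t|] with j hj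
      rw [Set.indicator_of_mem]
      rw [abs_lt] at hj
      exact ⟨hj.1, hj.2.le⟩
  have hval : (1 / (2 * Real.pi : ℝ) : ℂ) *
      (∫ t : ℝ, (((Real.exp (-(sig L / 2) * t ^ 2) * Hinf : ℝ)) : ℂ)) =
      ((Hinf / Real.sqrt (2 * Real.pi * sig L) : ℝ) : ℂ) := by
    rw [integral_complex_ofReal, integral_mul_const, integral_gaussian]
    norm_cast
    have e : Real.pi / (sig L / 2) = (2 * Real.pi) ^ 2 / (2 * Real.pi * sig L) := by
      field_simp
    rw [e, Real.sqrt_div (by positivity), Real.sqrt_sq (by positivity)]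
    field_simp
  rw [← hval]
  refine (hdom.const_mul _).congr' ?_
  filter_upwards [hs, hn.eventually_ge_atTop (a + b), hn.eventually_gt_atTop 0] with j h1 h2 h3
  rw [coeff_eq a b s (n j) (N j) h2 h1 h3 (hl j)]

end partB3


section partC1

lemma card_inj_image {k n : ℕ} (S : Finset (Fin n)) (hS : S.card = k) :
    (Finset.univ.filter (fun p : Fin k → Fin n => Function.Injective p ∧
      Finset.univ.image p = S)).card = k.factorial := by
  have h : Fintype.card (Fin k ↪ S) = k.factorial := by
    rw [Fintype.card_embedding_eq]; simp [hS, Nat.descFactorial_self]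
  rw [← h, ← Finset.card_univ]
  symm
  refine Finset.card_bij (fun e _ => fun x => ((e x : S) : Fin n)) ?_ ?_ ?_
  · intro e _
    simp only [Finset.mem_filter, Finset.mem_univ, true_and]
    have hinj : Function.Injective (fun x => ((e x : S) : Fin n)) :=
      Subtype.val_injective.comp e.injective
    refine ⟨hinj, ?_⟩
    apply Finset.eq_of_subset_of_card_le
    · intro y hy
      obtain ⟨x, _, rfl⟩ := Finset.mem_image.1 hy
      exact (e x).2
    · rw [Finset.card_image_of_injective _ hinj, hS]; simp
  · intro e _ e' _ hh
    ext x
    have := congrFun hh x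
    simpa using congrArg Fin.val this
  · intro p hp
    simp only [Finset.mem_filter, Finset.mem_univ, true_and] at hp
    refine ⟨⟨fun x => ⟨p x, ?_⟩, ?_⟩, Finset.mem_univ _, rfl⟩
    · rw [← hp.2]; exact Finset.mem_image_of_mem _ (Finset.mem_univ x)
    · intro x y hxy
      exact hp.1 (congrArg Subtype.val hxy)

noncomputable def toMat {k m n : ℕ} (φ : Fin m × Fin k → Fin n) : Matrix (Fin m) (Fin n) (ZMod 2) :=
  fun i j => if ∃ a, φ (i, a) = j then 1 else 0

lemma toMat_eq_one {k m n : ℕ} (φ : Fin m × Fin k → Fin n) (i : Fin m) (j : Fin n) :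
    toMat φ i j = 1 ↔ ∃ a, φ (i, a) = j := by
  unfold toMat
  split_ifs with h <;> simp [h]

lemma row_filter {k m n : ℕ} (φ : Fin m × Fin k → Fin n) (i : Fin m) :
    Finset.univ.filter (fun j => toMat φ i j = 1) = Finset.univ.image (fun a => φ (i, a)) := by
  ext j
  simp [toMat_eq_one]

lemma col_card {k m n : ℕ} (φ : Fin m × Fin k → Fin n)
    (h : ∀ i, Function.Injective (fun a => φ (i, a))) (j : Fin n) :
    (Finset.univ.filter (fun i => toMat φ i j = 1)).card =
      (Finset.univ.filter (fun p : Fin m × Fin k => φ p = j)).card := by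
  symm
  refine Finset.card_bij (fun p _ => p.1) ?_ ?_ ?_
  · rintro ⟨i, a⟩ hp
    simp only [Finset.mem_filter, Finset.mem_univ, true_and] at hp ⊢
    exact (toMat_eq_one φ i j).2 ⟨a, hp⟩
  · rintro ⟨i, a⟩ hp ⟨i', a'⟩ hp' hii
    simp only [Finset.mem_filter, Finset.mem_univ, true_and] at hp hp'
    simp only at hii
    subst hii
    have := h i (hp.trans hp'.symm)
    rw [this]
  · intro i hi
    simp only [Finset.mem_filter, Finset.mem_univ, true_and] at hi
    obtain ⟨a, ha⟩ := (toMat_eq_one φ i j).1 hi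
    exact ⟨(i, a), by simpa using ha, rfl⟩

lemma zmod2_eq {x y : ZMod 2} (h : x = 1 ↔ y = 1) : x = y := by
  revert x y; decide

lemma card_matrix_eq (k m n : ℕ) :
    ((chipSet k m n).filter (fun φ => ∀ i, Function.Injective (fun a => φ (i, a)))).card =
      k.factorial ^ m * (constrainedSet k m n).card := by
  rw [Finset.card_eq_sum_card_fiberwise (f := toMat) (t := constrainedSet k m n)]
  · rw [Finset.sum_const_nat (m := k.factorial ^ m), mul_comm]
    intro A hA
    simp only [constrainedSet, Finset.mem_filter, Finset.mem_univ, true_and] at hA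
    have hcard : (Fintype.piFinset (fun i : Fin m => Finset.univ.filter (fun p : Fin k → Fin n =>
        Function.Injective p ∧ Finset.univ.image p =
          Finset.univ.filter (fun j => A i j = 1)))).card = k.factorial ^ m := by
      rw [Fintype.card_piFinset]
      rw [Finset.prod_congr rfl (fun i _ => card_inj_image _ (hA.1 i))]
      simp
    rw [← hcard]
    refine Finset.card_bij (fun φ _ => fun i a => φ (i, a)) ?_ ?_ ?_
    · intro φ hφ
      simp only [Finset.mem_filter] at hφ
      simp only [Fintype.mem_piFinset, Finset.mem_filter, Finset.mem_univ, true_and]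
      intro i
      refine ⟨hφ.1.2 i, ?_⟩
      rw [← hφ.2, row_filter]
    · intro φ _ φ' _ hh
      funext ⟨i, a⟩
      exact congrFun (congrFun hh i) a
    · intro p hp
      simp only [Fintype.mem_piFinset, Finset.mem_filter, Finset.mem_univ, true_and] at hp
      refine ⟨fun x => p x.1 x.2, ?_, rfl⟩
      have hmat : toMat (fun x : Fin m × Fin k => p x.1 x.2) = A := by
        ext i j
        apply zmod2_eq
        rw [toMat_eq_one]
        have := (hp i).2
        have h2 := Finset.ext_iff.1 this j
        simpa using h2
      have hinj : ∀ i, Function.Injective (fun a => (fun x : Fin m × Fin k => p x.1 x.2) (i, a)) :=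
        fun i => (hp i).1
      simp only [Finset.mem_filter, chipSet, Finset.mem_univ, true_and]
      refine ⟨⟨fun j => ?_, hinj⟩, hmat⟩
      rw [← col_card _ hinj j, hmat]
      exact hA.2 j
  · intro φ hφ
    simp only [Finset.coe_filter, Set.mem_ofPred_eq, chipSet, Finset.mem_filter, Finset.mem_univ,
      true_and] at hφ
    simp only [constrainedSet, Finset.coe_filter, Set.mem_ofPred_eq, Finset.mem_univ, true_and]
    constructor
    · intro i
      rw [row_filter, Finset.card_image_of_injective _ (hφ.2 i)]; simp
    · intro j
      rw [col_card φ hφ.2 j]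
      exact hφ.1 j

/-- Bonferroni for one integer. -/
lemma bonf (x R : ℕ) :
    |(if x = 0 then (1:ℝ) else 0) - ∑ r ∈ Finset.range R, (-1) ^ r * (x.choose r : ℝ)| ≤ x.choose R := by
  cases R with
  | zero => simp; split_ifs <;> simp
  | succ R =>
    cases x with
    | zero =>
      rw [Finset.sum_range_succ']
      simp
    | succ x =>
      have h := @Int.alternating_sum_range_choose_eq_choose x R
      have h' : ∑ r ∈ Finset.range (R+1), ((-1:ℝ)) ^ r * ((x+1).choose r : ℝ) = (-1) ^ R * x.choose R := by
        exact_mod_cast h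
      rw [h']
      simp only [Nat.add_eq_zero_iff, one_ne_zero, and_false, if_false, zero_sub, abs_neg, abs_mul,
        abs_pow, abs_one, one_pow, one_mul, Nat.abs_cast]
      rw [Nat.choose_succ_succ]
      push_cast
      simp

def badRow {k m n : ℕ} (φ : Fin m × Fin k → Fin n) (i : Fin m) : Prop :=
  ¬ Function.Injective (fun a => φ (i, a))

noncomputable def SS (k m n r : ℕ) : ℕ :=
  ∑ S ∈ (Finset.univ : Finset (Fin m)).powersetCard r,
    ((chipSet k m n).filter (fun φ => ∀ i ∈ S, badRow φ i)).card

lemma SS_eq (k m n r : ℕ) : SS k m n r =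
    ∑ φ ∈ chipSet k m n, ((Finset.univ.filter (fun i => badRow φ i)).card).choose r := by
  unfold SS
  simp_rw [Finset.card_filter]
  rw [Finset.sum_comm]
  refine Finset.sum_congr rfl fun φ _ => ?_
  rw [← Finset.card_filter, ← Finset.card_filter, ← Finset.card_powersetCard]
  congr 1
  ext S
  simp only [Finset.mem_filter, Finset.mem_powersetCard, true_and,
    Finset.subset_iff, Finset.mem_univ]
  tauto

lemma bonf_chip (k m n R : ℕ) :
    |((k.factorial : ℝ) ^ m * ((constrainedSet k m n).card : ℝ)) -
      ∑ r ∈ Finset.range R, (-1) ^ r * (SS k m n r : ℝ)| ≤ SS k m n R := by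
  have h0 : ((k.factorial : ℝ) ^ m * ((constrainedSet k m n).card : ℝ)) =
      ∑ φ ∈ chipSet k m n, (if (Finset.univ.filter (fun i => badRow φ i)).card = 0 then (1:ℝ) else 0) := by
    have := card_matrix_eq k m n
    have h2 : ((k.factorial : ℝ) ^ m * ((constrainedSet k m n).card : ℝ)) =
      (((chipSet k m n).filter (fun φ => ∀ i, Function.Injective (fun a => φ (i, a)))).card : ℝ) := by
      rw [this]; push_cast; rfl
    rw [h2, Finset.card_filter]
    push_cast
    refine Finset.sum_congr rfl fun φ _ => ?_
    congr 1
    apply propext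
    rw [Finset.card_eq_zero, Finset.filter_eq_empty_iff]
    simp only [badRow, Finset.mem_univ, not_not, forall_const]
  have h1 : ∑ r ∈ Finset.range R, (-1) ^ r * (SS k m n r : ℝ) =
      ∑ φ ∈ chipSet k m n, ∑ r ∈ Finset.range R, (-1:ℝ) ^ r *
        (((Finset.univ.filter (fun i => badRow φ i)).card).choose r : ℝ) := by
    rw [Finset.sum_comm]
    refine Finset.sum_congr rfl fun r _ => ?_
    rw [SS_eq]; push_cast
    rw [Finset.mul_sum]
  rw [h0, h1, ← Finset.sum_sub_distrib, SS_eq]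
  push_cast
  refine (Finset.abs_sum_le_sum_abs _ _).trans ?_
  exact Finset.sum_le_sum fun φ _ => bonf _ _

end partC1


section partC2

noncomputable def cnt {α : Type} [Fintype α] {n : ℕ} (g : α → Fin n) (j : Fin n) : ℕ :=
  (Finset.univ.filter (fun x => g x = j)).card

noncomputable def aa {α : Type} [Fintype α] {n : ℕ} (g : α → Fin n) : ℕ :=
  (Finset.univ.filter (fun j => cnt g j = 1)).card

noncomputable def bb {α : Type} [Fintype α] {n : ℕ} (g : α → Fin n) : ℕ :=
  (Finset.univ.filter (fun j => 2 ≤ cnt g j)).card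

noncomputable def badG (k r n : ℕ) : Finset (Fin r × Fin k → Fin n) :=
  Finset.univ.filter (fun g => ∀ i, badRow g i)

lemma prod_TT {α : Type} [Fintype α] {n : ℕ} (g : α → Fin n) :
    (fun z => ∏ j, TT (2 - cnt g j) z) = PP n (aa g) (bb g) := by
  funext z
  have h1 : ∀ j, TT (2 - cnt g j) z = (if cnt g j = 0 then TT 2 z else 1) *
      (if cnt g j = 1 then TT 1 z else 1) * (if 2 ≤ cnt g j then TT 0 z else 1) := by
    intro j
    rcases Nat.lt_or_ge (cnt g j) 2 with h | h
    · interval_cases (cnt g j) <;> simp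
    · have h2 : 2 - cnt g j = 0 := by omega
      rw [h2, if_neg (by omega), if_neg (by omega), if_pos h]; simp
  simp_rw [h1]
  rw [Finset.prod_mul_distrib, Finset.prod_mul_distrib]
  simp only [Finset.prod_ite, Finset.prod_const, one_pow, mul_one]
  unfold PP
  have h3 : (Finset.univ.filter (fun j => cnt g j = 0)).card = n - (aa g + bb g) := by
    have e0 : (Finset.univ.filter (fun j => cnt g j = 0)).card + aa g + bb g = n := by
      unfold aa bb
      simp only [Finset.card_filter]
      rw [← Finset.sum_add_distrib, ← Finset.sum_add_distrib]
      have : ∀ j ∈ (Finset.univ : Finset (Fin n)), ((if cnt g j = 0 then 1 else 0) +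
        (if cnt g j = 1 then 1 else 0)) + (if 2 ≤ cnt g j then 1 else 0) = 1 := by
        intro j _
        split_ifs <;> omega
      rw [Finset.sum_congr rfl this]; simp
    omega
  rw [h3]; rfl

lemma image_card {α : Type} [Fintype α] {n : ℕ} (g : α → Fin n) :
    aa g + bb g = (Finset.univ.image g).card := by
  have e : Finset.univ.image g = Finset.univ.filter (fun j => 1 ≤ cnt g j) := by
    ext j
    simp only [Finset.mem_image, Finset.mem_univ, true_and, Finset.mem_filter, cnt,
      Finset.one_le_card]
    constructor
    · rintro ⟨x, rfl⟩; exact ⟨x, by simp⟩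
    · rintro ⟨x, hx⟩; exact ⟨x, by simpa using hx⟩
  rw [e]
  unfold aa bb
  simp only [Finset.card_filter]
  rw [← Finset.sum_add_distrib]
  refine Finset.sum_congr rfl fun j _ => ?_
  split_ifs <;> omega

lemma sum_cnt {α : Type} [Fintype α] {n : ℕ} (g : α → Fin n) : ∑ j, cnt g j = Fintype.card α := by
  unfold cnt
  rw [← Finset.card_univ]
  exact (Finset.card_eq_sum_card_fiberwise (fun x _ => Finset.mem_coe.2 (Finset.mem_univ _))).symm

lemma two_bb_le {α : Type} [Fintype α] {n : ℕ} (g : α → Fin n) : aa g + 2 * bb g ≤ Fintype.card α := by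
  rw [← sum_cnt g]
  unfold aa bb
  simp only [Finset.card_filter]
  rw [Finset.mul_sum, ← Finset.sum_add_distrib]
  refine Finset.sum_le_sum fun j _ => ?_
  split_ifs <;> omega

lemma card_bad_ext (k m n r : ℕ) (S : Finset (Fin m)) (hS : S.card = r) :
    ((chipSet k m n).filter (fun φ => ∀ i ∈ S, badRow φ i)).card =
    ∑ g ∈ badG k r n, (Finset.univ.filter (fun h : Fin (m - r) × Fin k → Fin n =>
      ∀ j, 2 - cnt g j ≤ (Finset.univ.filter (fun x => h x = j)).card)).card := by
  let e1 : {i // i ∈ S} ≃ Fin r := S.equivFinOfCardEq hS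
  have hc : Fintype.card {i // ¬ i ∈ S} = m - r := by
    rw [Fintype.card_subtype_compl]; simp [hS]
  let e2 : {i // ¬ i ∈ S} ≃ Fin (m - r) := Fintype.equivFinOfCardEq hc
  let e : Fin r ⊕ Fin (m - r) ≃ Fin m :=
    (Equiv.sumCongr e1.symm e2.symm).trans (Equiv.sumCompl (fun i => i ∈ S))
  have he1 : ∀ x : Fin r, e (Sum.inl x) ∈ S := by
    intro x; simp [e]
  have he2 : ∀ i ∈ S, ∃ x : Fin r, e (Sum.inl x) = i := by
    intro i hi
    exact ⟨e1 ⟨i, hi⟩, by simp [e]⟩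
  let E : (Fin r × Fin k) ⊕ (Fin (m - r) × Fin k) ≃ Fin m × Fin k :=
    (Equiv.sumProdDistrib _ _ _).symm.trans (Equiv.prodCongr e (Equiv.refl _))
  have hE : ∀ x a, E (Sum.inl (x, a)) = (e (Sum.inl x), a) := by
    intro x a; simp [E]
  have hcnt : ∀ (φ : Fin m × Fin k → Fin n) j,
      (Finset.univ.filter (fun p : Fin m × Fin k => φ p = j)).card =
      cnt (fun x => φ (E (Sum.inl x))) j +
        (Finset.univ.filter (fun x : Fin (m - r) × Fin k => φ (E (Sum.inr x)) = j)).card := by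
    intro φ j
    unfold cnt
    simp only [Finset.card_filter]
    rw [← Equiv.sum_comp E, Fintype.sum_sum_type]
  have hbad : ∀ (φ : Fin m × Fin k → Fin n),
      (∀ i ∈ S, badRow φ i) ↔ ∀ x, badRow (fun y : Fin r × Fin k => φ (E (Sum.inl y))) x := by
    intro φ
    constructor
    · intro h x
      have := h _ (he1 x)
      unfold badRow at this ⊢
      simpa only [hE] using this
    · intro h i hi
      obtain ⟨x, rfl⟩ := he2 i hi
      have := h x
      unfold badRow at this ⊢
      simpa only [hE] using this
  rw [← Finset.card_sigma]
  refine Finset.card_bij (fun φ _ => ⟨fun x => φ (E (Sum.inl x)), fun x => φ (E (Sum.inr x))⟩) ?_ ?_ ?_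
  · intro φ hφ
    simp only [chipSet, Finset.mem_filter, Finset.mem_univ, true_and] at hφ
    simp only [Finset.mem_sigma, badG, Finset.mem_filter, Finset.mem_univ, true_and]
    refine ⟨(hbad φ).1 hφ.2, fun j => ?_⟩
    have := hφ.1 j
    rw [hcnt] at this
    omega
  · intro φ _ φ' _ h
    simp only [Sigma.mk.injEq, heq_eq_eq] at h
    funext p
    obtain ⟨y, rfl⟩ := E.surjective p
    rcases y with y | y
    · exact congrFun h.1 y
    · exact congrFun h.2 y
  · rintro ⟨g, h⟩ hgh
    simp only [Finset.mem_sigma, badG, Finset.mem_filter, Finset.mem_univ, true_and] at hgh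
    have r1 : (fun x => (fun p => Sum.elim g h (E.symm p)) (E (Sum.inl x))) = g := by
      funext x; simp
    have r2 : (fun x => (fun p => Sum.elim g h (E.symm p)) (E (Sum.inr x))) = h := by
      funext x; simp
    refine ⟨fun p => Sum.elim g h (E.symm p), ?_, ?_⟩
    · simp only [chipSet, Finset.mem_filter, Finset.mem_univ, true_and]
      refine ⟨fun j => ?_, ?_⟩
      · rw [hcnt]
        rw [r1]
        have := hgh.2 j
        have r3 : ∀ x, Sum.elim g h (E.symm (E (Sum.inr x))) = h x := fun x => by simp
        simp only [r3]
        omega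
      · rw [hbad, r1]; exact hgh.1
    · rw [r1, r2]

noncomputable def GG (k r n a b : ℕ) : ℕ :=
  ((badG k r n).filter (fun g => aa g = a ∧ bb g = b)).card

lemma SS_formula (k m n r : ℕ) :
    (SS k m n r : ℂ) = (m.choose r : ℂ) * ∑ p ∈ Finset.range (r * k + 1) ×ˢ Finset.range (r * k + 1),
      (GG k r n p.1 p.2 : ℂ) * iteratedDeriv (k * m - r * k) (PP n p.1 p.2) 0 := by
  have h1 : ∀ S ∈ (Finset.univ : Finset (Fin m)).powersetCard r,
      ((((chipSet k m n).filter (fun φ => ∀ i ∈ S, badRow φ i)).card : ℕ) : ℂ) =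
      ∑ p ∈ Finset.range (r * k + 1) ×ˢ Finset.range (r * k + 1),
      (GG k r n p.1 p.2 : ℂ) * iteratedDeriv (k * m - r * k) (PP n p.1 p.2) 0 := by
    intro S hS
    rw [card_bad_ext k m n r S (Finset.mem_powersetCard.1 hS).2]
    push_cast
    have h2 : ∀ g ∈ badG k r n, (((Finset.univ.filter (fun h : Fin (m - r) × Fin k → Fin n =>
      ∀ j, 2 - cnt g j ≤ (Finset.univ.filter (fun x => h x = j)).card)).card : ℕ) : ℂ) =
      iteratedDeriv (k * m - r * k) (PP n (aa g) (bb g)) 0 := by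
      intro g _
      rw [card_ext (fun j => 2 - cnt g j), prod_TT]
      congr 1
      rw [Fintype.card_prod, Fintype.card_fin, Fintype.card_fin, Nat.sub_mul, mul_comm m k]
    rw [Finset.sum_congr rfl h2]
    rw [← Finset.sum_fiberwise_of_maps_to (s := badG k r n) (g := fun g => (aa g, bb g))
      (t := Finset.range (r * k + 1) ×ˢ Finset.range (r * k + 1))]
    · refine Finset.sum_congr rfl fun p _ => ?_
      have h3 : ∀ g ∈ (badG k r n).filter (fun g => (aa g, bb g) = p),
          iteratedDeriv (k * m - r * k) (PP n (aa g) (bb g)) 0 =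
          iteratedDeriv (k * m - r * k) (PP n p.1 p.2) 0 := by
        intro g hg
        have := (Finset.mem_filter.1 hg).2
        rw [← this]
      rw [Finset.sum_congr rfl h3, Finset.sum_const, nsmul_eq_mul]
      congr 2
      unfold GG
      congr 1
      ext g
      simp [Prod.ext_iff]
    · intro g _
      have := two_bb_le g
      simp only [Fintype.card_prod, Fintype.card_fin] at this
      simp only [Finset.mem_product, Finset.mem_range]
      omega
  unfold SS
  push_cast
  rw [Finset.sum_congr rfl h1, Finset.sum_const, Finset.card_powersetCard, nsmul_eq_mul]
  simp

lemma chip_formula (k m n : ℕ) :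
    ((chipSet k m n).card : ℂ) = iteratedDeriv (k * m) (PP n 0 0) 0 := by
  have h := card_ext (α := Fin m × Fin k) (n := n) (fun _ => 2)
  have e : (fun z => ∏ _j : Fin n, TT 2 z) = PP n 0 0 := by
    funext z; simp [PP]
  rw [e] at h
  simp only [Fintype.card_prod, Fintype.card_fin] at h
  rw [mul_comm k m, ← h]
  rfl

end partC2


section partC3
open Filter Topology

lemma bad_key {k r n : ℕ} (g : Fin r × Fin k → Fin n) (hg : g ∈ badG k r n)
    (hi : r * (k - 1) ≤ (Finset.univ.image g).card) : aa g = r * (k - 2) ∧ bb g = r := by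
  have hb : ∀ i, ∃ p q : Fin k, p ≠ q ∧ g (i, p) = g (i, q) := by
    intro i
    have := (Finset.mem_filter.1 hg).2 i
    unfold badRow Function.Injective at this
    push Not at this
    obtain ⟨p, q, h1, h2⟩ := this
    exact ⟨p, q, h2, h1⟩
  choose p q hpq hgpq using hb
  let R : Finset (Fin r × Fin k) := Finset.univ.filter (fun x => x.2 ≠ p x.1)
  have hR : R.card = r * (k - 1) := by
    have : R = (Finset.univ.sigma (fun i : Fin r => (Finset.univ.erase (p i)))).map
        (Equiv.sigmaEquivProd (Fin r) (Fin k)).toEmbedding := by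
      ext x
      simp [R]
    rw [this, Finset.card_map, Finset.card_sigma]
    simp
  have himg : Finset.univ.image g = R.image g := by
    apply Finset.Subset.antisymm
    · intro y hy
      obtain ⟨⟨i, a⟩, -, rfl⟩ := Finset.mem_image.1 hy
      by_cases h : a = p i
      · subst h
        refine Finset.mem_image.2 ⟨(i, q i), ?_, (hgpq i).symm⟩
        simp [R, (hpq i).symm]
      · exact Finset.mem_image.2 ⟨(i, a), by simp [R, h], rfl⟩
    · exact Finset.image_subset_image (Finset.subset_univ _)
  have hcard : (R.image g).card = R.card := by
    apply le_antisymm Finset.card_image_le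
    rw [← himg, hR]; exact hi
  have hinj : Set.InjOn g R := Finset.card_image_iff.1 hcard
  have hbb : r ≤ bb g := by
    have : (Finset.univ.image (fun i => g (i, q i))).card = r := by
      rw [Finset.card_image_of_injective]
      · simp
      · intro i i' h
        have := hinj (by simp [R, (hpq i).symm]) (by simp [R, (hpq i').symm]) h
        exact (Prod.ext_iff.1 this).1
    refine this.symm.le.trans ?_
    unfold bb
    apply Finset.card_le_card
    intro y hy
    obtain ⟨i, -, rfl⟩ := Finset.mem_image.1 hy
    simp only [Finset.mem_filter, Finset.mem_univ, true_and]
    unfold cnt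
    have h2 : ({(i, p i), (i, q i)} : Finset (Fin r × Fin k)).card = 2 := by
      rw [Finset.card_pair]; simp [hpq i]
    rw [← h2]
    apply Finset.card_le_card
    intro x hx
    simp only [Finset.mem_insert, Finset.mem_singleton] at hx
    rcases hx with rfl | rfl
    · simp [hgpq i]
    · simp
  have h1 := image_card g
  have h2 := two_bb_le g
  rw [himg, hcard, hR] at h1
  simp only [Fintype.card_prod, Fintype.card_fin] at h2
  rcases Nat.eq_zero_or_pos r with h0 | h0
  · subst h0; simp at h1 h2 ⊢; omega
  · have : 2 ≤ k := by
      have := hpq ⟨0, h0⟩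
      by_contra hk
      have hk' : k ≤ 1 := by omega
      apply this
      ext
      have := (p ⟨0, h0⟩).2
      have := (q ⟨0, h0⟩).2
      omega
    obtain ⟨l, rfl⟩ := Nat.exists_eq_add_of_le this
    have e1 : 2 + l - 1 = l + 1 := by omega
    have e2 : 2 + l - 2 = l := by omega
    rw [e1] at h1; rw [e2]
    have e3 : r * (l + 1) = r * l + r := by ring
    have e4 : r * (2 + l) = r * l + 2 * r := by ring
    rw [e3] at h1; rw [e4] at h2
    omega

noncomputable def small (r k n t : ℕ) : ℕ :=
  (Finset.univ.filter (fun g : Fin r × Fin k → Fin n => (Finset.univ.image g).card < t)).card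

lemma small_le (r k n t : ℕ) (hn : 0 < n) : small r k n (t + 1) ≤ n ^ t * t ^ (r * k) := by
  have hc : (Finset.univ : Finset ((Fin t → Fin n) × (Fin r × Fin k → Fin t))).card = n ^ t * t ^ (r * k) := by
    simp
  rw [← hc]
  unfold small
  refine Finset.card_le_card_of_surjOn (fun vw => vw.1 ∘ vw.2) ?_
  intro g hg
  have hg' : (Finset.univ.image g).card < t + 1 := by
    have := Finset.mem_coe.1 hg
    exact (Finset.mem_filter.1 this).2
  have : Nonempty ({y // y ∈ Finset.univ.image g} ↪ Fin t) := by
    rw [Function.Embedding.nonempty_iff_card_le]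
    rw [Fintype.card_coe, Fintype.card_fin]
    omega
  obtain ⟨e⟩ := this
  have : Nonempty (Fin n) := ⟨⟨0, hn⟩⟩
  refine ⟨(Function.extend e (fun y => y.1) (fun _ => ⟨0, hn⟩), fun x => e ⟨g x, by simp⟩), by simp, ?_⟩
  funext x
  simp only [Function.comp]
  rw [e.injective.extend_apply]

lemma small_lim (r k t : ℕ) : Tendsto (fun n : ℕ => (small r k n t : ℝ) / (n:ℝ)^t) atTop (𝓝 0) := by
  rcases t with _ | t
  · simp [small]
  · have h : Tendsto (fun n : ℕ => (t ^ (r * k) : ℝ) / (n:ℝ)) atTop (𝓝 0) :=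
      tendsto_const_div_atTop_nhds_zero_nat _
    refine squeeze_zero' (Eventually.of_forall fun n => by positivity) ?_ h
    filter_upwards [eventually_gt_atTop 0] with n hn
    have h1 : (small r k n (t+1) : ℝ) ≤ (n:ℝ) ^ t * (t:ℝ) ^ (r * k) := by exact_mod_cast small_le r k n t hn
    have hn' : (0:ℝ) < n := by positivity
    rw [div_le_div_iff₀ (by positivity) hn']
    calc (small r k n (t+1) : ℝ) * n ≤ ((n:ℝ) ^ t * (t:ℝ) ^ (r * k)) * n := by gcongr
      _ = _ := by ring

lemma non_inj (k : ℕ) : Tendsto (fun n : ℕ => ((n:ℝ)^(k+1) - n.descFactorial (k+1)) / (n:ℝ)^k) atTop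
    (𝓝 ((k+1) * k / 2)) := by
  induction k with
  | zero => simp
  | succ k ih =>
    have h1 : Tendsto (fun n : ℕ => (n.descFactorial (k+1) : ℝ) / (n:ℝ)^(k+1)) atTop (𝓝 1) := by
      have := (isEquivalent_descFactorial (k+1))
      rw [Asymptotics.isEquivalent_iff_tendsto_one] at this
      · exact this
      · filter_upwards [eventually_gt_atTop 0] with n hn
        positivity
    have h2 := ih.add (h1.mul_const ((k:ℝ)+1))
    have e : ((k:ℝ)+1) * k / 2 + 1 * (k+1) = ((k+1:ℕ)+1) * (k+1:ℕ)/2 := by push_cast; ring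
    rw [e] at h2
    refine h2.congr' ?_
    filter_upwards [eventually_ge_atTop (k+1)] with n hn
    have hn0 : (n:ℝ) ≠ 0 := by
      have : 0 < n := by omega
      positivity
    rw [Nat.descFactorial_succ n (k+1)]
    push_cast [Nat.cast_sub hn]
    field_simp
    ring

lemma badG_card (k r n : ℕ) : (badG k r n).card = (n ^ k - n.descFactorial k) ^ r := by
  have h1 : (Finset.univ.filter (fun f : Fin k → Fin n => ¬ Function.Injective f)).card = n ^ k - n.descFactorial k := by
    have h := Finset.card_filter_add_card_filter_not (s := (Finset.univ : Finset (Fin k → Fin n))) (fun f => Function.Injective f)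
    have h2 : (Finset.univ.filter (fun f : Fin k → Fin n => Function.Injective f)).card = n.descFactorial k := by
      rw [← Fintype.card_subtype]
      have := Fintype.card_embedding_eq (α := Fin k) (β := Fin n)
      simp only [Fintype.card_fin] at this
      rw [← this]
      exact Fintype.card_congr (Equiv.subtypeInjectiveEquivEmbedding _ _)
    simp at h
    omega
  rw [← h1]
  have : (badG k r n).card = (Fintype.piFinset (fun _ : Fin r => Finset.univ.filter (fun f : Fin k → Fin n => ¬ Function.Injective f))).card := by
    refine Finset.card_bij (fun g _ => Function.curry g) ?_ ?_ ?_
    · intro g hg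
      rw [Fintype.mem_piFinset]
      exact fun i => Finset.mem_filter.2 ⟨Finset.mem_univ _, (Finset.mem_filter.1 hg).2 i⟩
    · intro g _ g' _ h
      funext x
      exact congrFun (congrFun h x.1) x.2
    · intro h hh
      refine ⟨Function.uncurry h, ?_, by simp⟩
      rw [Fintype.mem_piFinset] at hh
      exact Finset.mem_filter.2 ⟨Finset.mem_univ _, fun i => (Finset.mem_filter.1 (hh i)).2⟩
  rw [this, Fintype.card_piFinset]
  simp

lemma badG_lim (k r : ℕ) (hk : 1 ≤ k) : Tendsto (fun n : ℕ => ((badG k r n).card : ℝ) / (n:ℝ)^(r * (k-1))) atTop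
    (𝓝 (((k:ℝ) * (k - 1) / 2) ^ r)) := by
  obtain ⟨l, rfl⟩ := Nat.exists_eq_add_of_le' hk
  have h := (non_inj l).pow r
  have e : ((l + 1 : ℕ) : ℝ) * ((l + 1 : ℕ) - 1) / 2 = (l+1) * l / 2 := by push_cast; ring
  rw [e]
  refine h.congr fun n => ?_
  rw [badG_card]
  have : n.descFactorial (l+1) ≤ n ^ (l+1) := Nat.descFactorial_le_pow n (l+1)
  push_cast [Nat.cast_sub this]
  rw [div_pow, ← pow_mul, mul_comm l r]

lemma GG_le_badG (k r n a b : ℕ) : GG k r n a b ≤ (badG k r n).card :=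
  Finset.card_le_card (Finset.filter_subset _ _)

lemma GG_le_small (k r n a b : ℕ) (h : ¬ (a = r * (k - 2) ∧ b = r)) :
    GG k r n a b ≤ small r k n (r * (k - 1)) := by
  apply Finset.card_le_card
  intro g hg
  obtain ⟨h1, h2, h3⟩ := Finset.mem_filter.1 hg
  refine Finset.mem_filter.2 ⟨Finset.mem_univ _, ?_⟩
  by_contra hc
  obtain ⟨h4, h5⟩ := bad_key g h1 (not_lt.1 hc)
  exact h ⟨h2 ▸ h4, h3 ▸ h5⟩

lemma badG_le (k r n : ℕ) :
    (badG k r n).card ≤ GG k r n (r * (k - 2)) r + small r k n (r * (k - 1)) := by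
  refine le_trans (Finset.card_le_card ?_) (Finset.card_union_le _ _)
  intro g hg
  by_cases hc : (Finset.univ.image g).card < r * (k - 1)
  · exact Finset.mem_union_right _ (Finset.mem_filter.2 ⟨Finset.mem_univ _, hc⟩)
  · exact Finset.mem_union_left _ (Finset.mem_filter.2 ⟨hg, bad_key g hg (not_lt.1 hc)⟩)

lemma GG_lim (k r a b : ℕ) (hk : 1 ≤ k) :
    Tendsto (fun n : ℕ => (GG k r n a b : ℝ) / (n:ℝ)^(r * (k-1))) atTop
    (𝓝 (if a = r * (k - 2) ∧ b = r then ((k:ℝ) * (k - 1) / 2) ^ r else 0)) := by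
  split_ifs with h
  · obtain ⟨rfl, rfl⟩ := h
    have h1 := (badG_lim k b hk).sub (small_lim b k (b * (k - 1)))
    rw [sub_zero] at h1
    refine tendsto_of_tendsto_of_tendsto_of_le_of_le h1 (badG_lim k b hk) ?_ ?_
    · intro n
      have := badG_le k b n
      have h2 : ((badG k b n).card : ℝ) ≤ GG k b n (b * (k - 2)) b + small b k n (b * (k - 1)) := by
        exact_mod_cast this
      show _ / _ - _ / _ ≤ _ / _
      rw [← sub_div]
      gcongr
      linarith
    · intro n
      show _ / _ ≤ _ / _
      gcongr
      exact GG_le_badG _ _ _ _ _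
  · refine squeeze_zero (fun n => by positivity) (fun n => ?_) (small_lim r k (r * (k - 1)))
    gcongr
    exact GG_le_small _ _ _ _ _ h

end partC3

section partD
open Filter Topology

lemma bonf_lim {p : ℕ → ℝ} {S : ℕ → ℕ → ℝ} {g : ℝ}
    (hb : ∀ R, ∀ᶠ j in atTop, |p j - ∑ r ∈ Finset.range R, (-1) ^ r * S r j| ≤ S R j)
    (hS : ∀ r, Tendsto (S r) atTop (𝓝 (g ^ r / (r.factorial : ℝ)))) :
    Tendsto p atTop (𝓝 (Real.exp (-g))) := by
  have h1 : Tendsto (fun R => ∑ r ∈ Finset.range R, (-1) ^ r * (g ^ r / (r.factorial : ℝ))) atTop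
      (𝓝 (Real.exp (-g))) := by
    have := (NormedSpace.expSeries_div_hasSum_exp (-g)).tendsto_sum_nat
    rw [← Real.exp_eq_exp_ℝ] at this
    refine this.congr fun R => Finset.sum_congr rfl fun r _ => ?_
    rw [neg_pow]; ring
  have h2 : Tendsto (fun R : ℕ => g ^ R / (R.factorial : ℝ)) atTop (𝓝 0) :=
    FloorSemiring.tendsto_pow_div_factorial_atTop g
  rw [Metric.tendsto_atTop] at h1 h2
  rw [Metric.tendsto_nhds]
  intro ε hε
  obtain ⟨R1, hR1⟩ := h1 (ε / 4) (by positivity)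
  obtain ⟨R2, hR2⟩ := h2 (ε / 4) (by positivity)
  set R := max R1 R2
  have a1 := hR1 R (le_max_left _ _)
  have a2 := hR2 R (le_max_right _ _)
  have h3 : Tendsto (fun j => ∑ r ∈ Finset.range R, (-1) ^ r * S r j) atTop
      (𝓝 (∑ r ∈ Finset.range R, (-1) ^ r * (g ^ r / (r.factorial : ℝ)))) :=
    tendsto_finsetSum _ fun r _ => (hS r).const_mul _
  rw [Metric.tendsto_nhds] at h3
  have h4 := hS R
  rw [Metric.tendsto_nhds] at h4
  filter_upwards [hb R, h3 (ε/4) (by positivity), h4 (ε/4) (by positivity)] with j b1 b2 b3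
  rw [Real.dist_eq] at *
  rw [abs_lt] at *
  rw [abs_le] at b1
  constructor <;> linarith [b1.1, b1.2, b2.1, b2.2, b3.1, b3.2, a1.1, a1.2, a2.1, a2.2]

lemma desc_lim (s : ℕ) : Tendsto (fun N : ℕ => (N:ℝ)^s / (N.descFactorial s : ℝ)) atTop (𝓝 1) := by
  have := (isEquivalent_descFactorial s)
  rw [Asymptotics.isEquivalent_iff_tendsto_one] at this
  · have h := this.inv₀ one_ne_zero
    rw [inv_one] at h
    refine h.congr fun N => ?_
    simp
  · filter_upwards [eventually_gt_atTop 0] with n hn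
    positivity

lemma choose_lim (r : ℕ) : Tendsto (fun m : ℕ => (m.choose r : ℝ) / (m:ℝ)^r) atTop (𝓝 (1 / (r.factorial : ℝ))) := by
  have := (isEquivalent_choose r)
  rw [Asymptotics.isEquivalent_iff_tendsto_one] at this
  · have h := this.mul_const (1 / (r.factorial : ℝ))
    rw [one_mul] at h
    refine h.congr fun N => ?_
    have : (r.factorial : ℝ) ≠ 0 := by positivity
    simp only [Pi.div_apply]
    rcases eq_or_ne ((N:ℝ)^r) 0 with h0 | h0
    · rw [h0]; simp
    · field_simp
  · filter_upwards [eventually_gt_atTop 0] with n hn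
    positivity

lemma chip_lim {k : ℕ} (hk : 3 ≤ k) {m n : ℕ → ℕ} (hntop : Tendsto n atTop atTop)
    {lam : ℝ} (hlam : 0 < lam) {l : ℕ → ℝ} (hl : ∀ j, 0 < l j) (hlL : Tendsto l atTop (𝓝 lam))
    (hN : ∀ j, psi (l j) * n j = ((k * m j : ℕ) : ℝ)) :
    Tendsto (fun j => ((chipSet k (m j) (n j)).card : ℝ) / ((k * m j).factorial : ℝ) * l j ^ (k * m j) /
      fEx (l j) ^ n j * Real.sqrt (n j)) atTop (𝓝 (1 / Real.sqrt (2 * Real.pi * sig lam))) := by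
  have h := llt hntop hl hlam hlL hN 0 0 0 (Eventually.of_forall fun j => Nat.zero_le _)
  rw [← tendsto_ofReal_iff]
  convert h using 2 with j
  · push_cast
    rw [chip_formula]
    simp
  · simp

lemma SS_lim {k : ℕ} (hk : 3 ≤ k) {m n : ℕ → ℕ} (hm : ∀ j, 0 < m j) (hn : ∀ j, 0 < n j)
    (hmtop : Tendsto m atTop atTop) (hntop : Tendsto n atTop atTop)
    {lam : ℝ} (hlam : 0 < lam) {l : ℕ → ℝ} (hl : ∀ j, 0 < l j) (hlL : Tendsto l atTop (𝓝 lam))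
    (hN : ∀ j, psi (l j) * n j = ((k * m j : ℕ) : ℝ)) (r : ℕ) :
    Tendsto (fun j => (SS k (m j) (n j) r : ℝ) / ((chipSet k (m j) (n j)).card : ℝ)) atTop
      (𝓝 (((k - 1 : ℝ) / 2 * (lam * Real.exp lam / (Real.exp lam - 1))) ^ r / (r.factorial : ℝ))) := by
  have hNtop : Tendsto (fun j => k * m j) atTop atTop :=
    tendsto_atTop_mono (fun j => Nat.le_mul_of_pos_left _ (by omega)) hmtop
  have hs : ∀ᶠ j in atTop, r * k ≤ k * m j := hNtop.eventually_ge_atTop _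
  have hf : 0 < fEx lam := fEx_pos_s9 hlam
  have hsig : 0 < sig lam := sig_pos hlam
  have hE : 0 < Real.exp lam - 1 := by have := Real.add_one_lt_exp hlam.ne'; linarith
  have hpsi : psi lam = lam * (Real.exp lam - 1) / fEx lam := by
    unfold psi fEx; rw [if_neg hlam.ne']
  have hpsi0 : 0 < psi lam := by rw [hpsi]; positivity
  have hpl : Tendsto (fun j => psi (l j)) atTop (𝓝 (psi lam)) := (psi_continuousAt hlam).tendsto.comp hlL
  have hC := llt hntop hl hlam hlL hN 0 0 0 (Eventually.of_forall fun j => Nat.zero_le _)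
  have hsq : (0:ℝ) < Real.sqrt (2 * Real.pi * sig lam) := by positivity
  have hC0 : (((lam ^ 0 * ((Real.exp lam - 1) / fEx lam) ^ 0 * (Real.exp lam / fEx lam) ^ 0 /
    Real.sqrt (2 * Real.pi * sig lam) : ℝ)) : ℂ) ≠ 0 := by
    rw [Complex.ofReal_ne_zero]; simp only [pow_zero]; positivity
  have hQ : ∀ a b : ℕ, Tendsto (fun j => iteratedDeriv (k * m j - r * k) (PP (n j) a b) 0 /
      iteratedDeriv (k * m j) (PP (n j) 0 0) 0 * ((k * m j).descFactorial (r * k) : ℂ)) atTop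
      (𝓝 ((lam ^ (r * k) * ((Real.exp lam - 1) / fEx lam) ^ a * (Real.exp lam / fEx lam) ^ b : ℝ) : ℂ)) := by
    intro a b
    have h := (llt hntop hl hlam hlL hN a b (r * k) hs).div hC hC0
    rw [← Complex.ofReal_div] at h
    have e : lam ^ (r * k) * ((Real.exp lam - 1) / fEx lam) ^ a * (Real.exp lam / fEx lam) ^ b /
      Real.sqrt (2 * Real.pi * sig lam) / (lam ^ 0 * ((Real.exp lam - 1) / fEx lam) ^ 0 *
        (Real.exp lam / fEx lam) ^ 0 / Real.sqrt (2 * Real.pi * sig lam)) =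
        lam ^ (r * k) * ((Real.exp lam - 1) / fEx lam) ^ a * (Real.exp lam / fEx lam) ^ b := by
      simp only [pow_zero]; field_simp
    rw [e] at h
    refine h.congr' ?_
    filter_upwards [hs] with j hj
    have hw1 : ((l j : ℂ)) ^ (k * m j) ≠ 0 := pow_ne_zero _ (by exact_mod_cast (hl j).ne')
    have hw2 : ((fEx (l j) : ℝ) : ℂ) ^ (n j) ≠ 0 := pow_ne_zero _ (by exact_mod_cast (fEx_pos_s9 (hl j)).ne')
    have hw3 : ((Real.sqrt (n j) : ℝ) : ℂ) ≠ 0 := by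
      have := hn j
      have : 0 < Real.sqrt (n j) := by positivity
      exact_mod_cast this.ne'
    have hw4 : (((k * m j - r * k).factorial : ℕ) : ℂ) ≠ 0 := by exact_mod_cast (Nat.factorial_ne_zero _)
    have hw5 : (((k * m j).factorial : ℕ) : ℂ) ≠ 0 := by exact_mod_cast (Nat.factorial_ne_zero _)
    have hd : (((k * m j - r * k).factorial : ℕ) : ℂ) * ((k * m j).descFactorial (r * k) : ℂ) =
      (((k * m j).factorial : ℕ) : ℂ) := by exact_mod_cast Nat.factorial_mul_descFactorial hj
    simp only [Nat.sub_zero, Pi.div_apply]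
    rw [← hd]
    have hw6 : ((k * m j).descFactorial (r * k) : ℂ) ≠ 0 := by
      intro h0; rw [h0, mul_zero] at hd; exact hw5 hd.symm
    rcases eq_or_ne (iteratedDeriv (k * m j) (PP (n j) 0 0) 0) 0 with h0 | h0
    · simp [h0]
    · field_simp
  have hM : Tendsto (fun j => ((m j:ℝ) * (n j:ℝ) ^ (k-1) / ((k * m j : ℕ):ℝ)^k)^r) atTop
      (𝓝 (((1 / psi lam) ^ (k-1) / k)^r)) := by
    have h := (((tendsto_const_nhds (x := (1:ℝ))).div hpl hpsi0.ne').pow (k-1)).div_const (k:ℝ)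
    refine (h.congr fun j => ?_).pow r
    have hm' : (0:ℝ) < m j := by exact_mod_cast hm j
    have hn' : (0:ℝ) < n j := by exact_mod_cast hn j
    have hk' : (0:ℝ) < k := by positivity
    have hps : psi (l j) = k * m j / n j := by
      rw [eq_div_iff hn'.ne', hN j]; push_cast; ring
    obtain ⟨q, rfl⟩ : ∃ q, k = q + 1 := ⟨k - 1, by omega⟩
    simp only [Pi.div_apply, hps, Nat.add_sub_cancel]
    push_cast
    push_cast at hk'
    rw [pow_succ, one_div_div, div_pow]
    field_simp
  have hT : ∀ p : ℕ × ℕ, Tendsto (fun j => ((m j).choose r : ℂ) * ((GG k r (n j) p.1 p.2 : ℂ) *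
      iteratedDeriv (k * m j - r * k) (PP (n j) p.1 p.2) 0) / iteratedDeriv (k * m j) (PP (n j) 0 0) 0) atTop
      (𝓝 ((1 / (r.factorial : ℝ) * (if p.1 = r * (k - 2) ∧ p.2 = r then ((k:ℝ) * (k - 1) / 2) ^ r else 0) *
        1 * (((1 / psi lam) ^ (k-1) / k)^r) : ℝ) *
        ((lam ^ (r * k) * ((Real.exp lam - 1) / fEx lam) ^ p.1 * (Real.exp lam / fEx lam) ^ p.2 : ℝ) : ℂ))) := by
    intro p
    have h1 := (((choose_lim r).comp hmtop).mul ((GG_lim k r p.1 p.2 (by omega)).comp hntop)).mul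
      ((desc_lim (r * k)).comp hNtop)
    have h2 := (tendsto_ofReal_iff.2 (h1.mul hM)).mul (hQ p.1 p.2)
    refine h2.congr' ?_
    filter_upwards [hs] with j hj
    simp only [Function.comp]
    push_cast
    have hm' : (m j : ℂ) ≠ 0 := by exact_mod_cast (hm j).ne'
    have hn' : (n j : ℂ) ≠ 0 := by exact_mod_cast (hn j).ne'
    have hk' : (k : ℂ) ≠ 0 := by
      have : k ≠ 0 := by omega
      exact_mod_cast this
    have hw6 : ((k * m j).descFactorial (r * k) : ℂ) ≠ 0 := by
      have h3 : (k * m j).descFactorial (r * k) ≠ 0 := by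
        rw [Ne, Nat.descFactorial_eq_zero_iff_lt]; omega
      exact_mod_cast h3
    have e1 : ((k:ℂ) * m j) ^ (r * k) = (((k:ℂ) * m j) ^ k) ^ r := by rw [← pow_mul, mul_comm r k]
    have e2 : (n j : ℂ) ^ (r * (k - 1)) = ((n j : ℂ) ^ (k - 1)) ^ r := by rw [← pow_mul, mul_comm r (k-1)]
    rw [e1, e2, div_pow, mul_pow]
    have hkm : ((k:ℂ) * m j) ^ k ≠ 0 := pow_ne_zero _ (mul_ne_zero hk' hm')
    generalize ((k:ℂ) * m j) ^ k = u at *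
    have hnk : (n j : ℂ) ^ (k - 1) ≠ 0 := pow_ne_zero _ hn'
    generalize (n j : ℂ) ^ (k - 1) = v at *
    generalize iteratedDeriv (k * m j) (PP (n j) 0 0) 0 = w
    generalize iteratedDeriv (k * m j - r * k) (PP (n j) p.1 p.2) 0 = w'
    rcases eq_or_ne w 0 with h0 | h0
    · simp [h0]
    · field_simp
      ring
  have hsum := tendsto_finsetSum (Finset.range (r * k + 1) ×ˢ Finset.range (r * k + 1)) (fun p _ => hT p)
  rw [← tendsto_ofReal_iff]
  convert hsum using 2 with j
  · push_cast
    rw [chip_formula, SS_formula, Finset.mul_sum, Finset.sum_div]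
  · have hr : r ≤ r * k := Nat.le_mul_of_pos_right _ (by omega)
    have hr2 : r * (k - 2) ≤ r * k := Nat.mul_le_mul_left _ (by omega)
    rw [Finset.sum_eq_single (r * (k - 2), r)]
    · rw [← Complex.ofReal_mul]
      congr 1
      simp only [and_self, if_true]
      obtain ⟨q, rfl⟩ : ∃ q, k = q + 2 := ⟨k - 2, by omega⟩
      have e1 : q + 2 - 1 = q + 1 := by omega
      rw [e1, Nat.add_sub_cancel, mul_comm r (q + 2), mul_comm r q, pow_mul, pow_mul]
      have hc : ∀ x y z u v : ℝ, 1 / (r.factorial : ℝ) * x ^ r * 1 * y ^ r * (z ^ r * u ^ r * v ^ r) =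
         (x * y * z * u * v) ^ r / (r.factorial : ℝ) := by
        intros; simp only [mul_pow]; ring
      rw [hc, hpsi]
      congr 2
      have hq : (0:ℝ) < ((q + 2 : ℕ) : ℝ) := by positivity
      generalize ((q + 2 : ℕ) : ℝ) = K at *
      generalize Real.exp lam = X at *
      generalize fEx lam = F at *
      generalize X - 1 = Y at *
      rw [one_div_div]
      simp only [div_pow, mul_pow]
      field_simp
      ring
    · rintro ⟨a, b⟩ _ hab
      rw [if_neg]
      · simp
      · rintro ⟨h1, h2⟩; exact hab (by simp only at h1 h2; rw [h1, h2])
    · intro h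
      exfalso; apply h
      simp only [Finset.mem_product, Finset.mem_range]; omega

end partD

theorem card_constrainedSet_asymptotics
    (k : ℕ) (hk : 3 ≤ k) (m n : ℕ → ℕ)
    (hm : ∀ j, 0 < m j) (hn : ∀ j, 0 < n j)
    (hmtop : Filter.Tendsto m Filter.atTop Filter.atTop)
    (hntop : Filter.Tendsto n Filter.atTop Filter.atTop)
    (c : ℝ) (hc : 2 / k < c)
    (hratio : Filter.Tendsto (fun j => (m j : ℝ) / (n j : ℝ)) Filter.atTop (nhds c))
    (lam : ℝ) (hlam : 0 < lam) (hroot : psi lam = c * k)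
    (lamj : ℕ → ℝ) (hlamj : ∀ j, 0 < lamj j)
    (hrootj : ∀ j, psi (lamj j) = k * (m j : ℝ) / (n j : ℝ)) :
    Filter.Tendsto
      (fun j => ((Nat.factorial k : ℝ) ^ (m j) * ((constrainedSet k (m j) (n j)).card : ℝ)) *
          lamj j ^ (k * m j) *
          Real.sqrt (2 * Real.pi * (n j : ℝ) * lamj j * deriv psi (lamj j)) /
          ((Nat.factorial (k * m j) : ℝ) * fEx (lamj j) ^ (n j)))
      Filter.atTop
      (nhds (Real.exp (-((k - 1 : ℝ) / 2 * (lam * Real.exp lam / (Real.exp lam - 1)))))) ∧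
    Filter.Tendsto
      (fun j => ((Nat.factorial k : ℝ) ^ (m j) * ((constrainedSet k (m j) (n j)).card : ℝ)) /
          ((chipSet k (m j) (n j)).card : ℝ))
      Filter.atTop
      (nhds (Real.exp (-((k - 1 : ℝ) / 2 * (lam * Real.exp lam / (Real.exp lam - 1)))))) := by
  have hN : ∀ j, psi (lamj j) * n j = ((k * m j : ℕ) : ℝ) := by
    intro j
    have : (n j : ℝ) ≠ 0 := by exact_mod_cast (hn j).ne'
    rw [hrootj j]; push_cast; field_simp
  have hlL : Filter.Tendsto lamj Filter.atTop (nhds lam) := by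
    refine tendsto_lamj hlam hlamj ?_
    rw [hroot]
    refine (hratio.mul_const (k:ℝ)).congr fun j => ?_
    rw [hrootj j]; ring
  have hsig : 0 < sig lam := sig_pos hlam
  have hsq : (0:ℝ) < Real.sqrt (2 * Real.pi * sig lam) := by positivity
  have hC := chip_lim hk hntop hlam hlamj hlL hN
  have hCpos : ∀ᶠ j in Filter.atTop, 0 < ((chipSet k (m j) (n j)).card : ℝ) := by
    have := hC.eventually_ne (by positivity : (1 / Real.sqrt (2 * Real.pi * sig lam)) ≠ 0)
    filter_upwards [this] with j hj
    by_contra h0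
    have h1 : ((chipSet k (m j) (n j)).card : ℝ) = 0 := le_antisymm (not_lt.1 h0) (by positivity)
    exact hj (by rw [h1]; simp)
  have h2 : Filter.Tendsto
      (fun j => ((Nat.factorial k : ℝ) ^ (m j) * ((constrainedSet k (m j) (n j)).card : ℝ)) /
          ((chipSet k (m j) (n j)).card : ℝ))
      Filter.atTop
      (nhds (Real.exp (-((k - 1 : ℝ) / 2 * (lam * Real.exp lam / (Real.exp lam - 1)))))) := by
    refine bonf_lim (S := fun r j => (SS k (m j) (n j) r : ℝ) / ((chipSet k (m j) (n j)).card : ℝ)) ?_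
      (SS_lim hk hm hn hmtop hntop hlam hlamj hlL hN)
    intro R
    filter_upwards [hCpos] with j hj
    have hb := bonf_chip k (m j) (n j) R
    rw [← div_le_div_iff_of_pos_right hj, ← abs_of_pos hj, ← abs_div, abs_of_pos hj, sub_div,
      Finset.sum_div] at hb
    simp only [mul_div_assoc] at hb ⊢
    exact hb
  refine ⟨?_, h2⟩
  have hS : Filter.Tendsto (fun j => Real.sqrt (2 * Real.pi * sig (lamj j))) Filter.atTop
      (nhds (Real.sqrt (2 * Real.pi * sig lam))) :=
    (((sig_continuousAt hlam).tendsto.comp hlL).const_mul (2 * Real.pi)).sqrt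
  have h3 := h2.mul (hC.mul hS)
  rw [one_div_mul_cancel hsq.ne', mul_one] at h3
  refine h3.congr' ?_
  filter_upwards [hCpos] with j hj
  have e : 2 * Real.pi * (n j : ℝ) * lamj j * deriv psi (lamj j) =
      (n j : ℝ) * (2 * Real.pi * sig (lamj j)) := by
    rw [← mul_deriv_psi_s9 (hlamj j)]; ring
  rw [e, Real.sqrt_mul (Nat.cast_nonneg (n j))]
  have hf := (fEx_pos_s9 (hlamj j)).ne'
  generalize Real.sqrt (2 * Real.pi * sig (lamj j)) = y
  generalize Real.sqrt (n j : ℝ) = z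
  field_simp
end
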